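/- arXiv:2504.12519 — 2 statements merged into one kernel-verified Lean document; each statement's English description precedes it below -/
import Mathlib

section
/- For every r ≠ 0 the limit F_V(r) = lim_{u,v→+∞} F_V^{(u,v)}(r) exists and is real. Moreover: (i) F_V(r) = 0 for every r < 0; (ii) F_V(r) → 1 as r → 0+; (iii) F_V(r) = (1+o(1))·(c/Γ(1−θ))·r^{−θ} as r → +∞, where Γ(1−θ) denotes the value of the Gamma function at 1−θ ∈ (−1,0). -/
open Filter Topology MeasureTheory

/-- The truncated integral
`(1/2π)·∫_{−u}^{v} c·e^{i·sign(s)(θ−1)π/2}·|s|^{θ−1}·e^{irs}/(c·e^{i·sign(s)θπ/2}·|s|^θ + 1) ds`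
whose limit as `u, v → ∞` defines `F_V(r)`. -/
noncomputable def FVapprox (c θ : ℝ) (u v r : ℝ) : ℂ :=
  (1 / (2 * Real.pi)) * ∫ s in (-u)..v,
    (c : ℂ) * Complex.exp (Complex.I * Real.sign s * (θ - 1) * Real.pi / 2) *
      ((|s| ^ (θ - 1) : ℝ) : ℂ) * Complex.exp (Complex.I * r * s) /
      ((c : ℂ) * Complex.exp (Complex.I * Real.sign s * θ * Real.pi / 2) *
        ((|s| ^ θ : ℝ) : ℂ) + 1)

noncomputable def FVg (c θ r s : ℝ) : ℂ :=
  (c : ℂ) * Complex.exp (Complex.I * (θ - 1) * Real.pi / 2) *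
      ((|s| ^ (θ - 1) : ℝ) : ℂ) * Complex.exp (Complex.I * r * s) /
      ((c : ℂ) * Complex.exp (Complex.I * θ * Real.pi / 2) *
        ((|s| ^ θ : ℝ) : ℂ) + 1)

noncomputable def FVH (c θ r : ℝ) (w : ℂ) : ℂ :=
  (c : ℂ) * Complex.exp (θ * w) / (1 + (c : ℂ) * Complex.exp (θ * w)) *
    Complex.exp (r * Complex.exp w)

lemma FV_den {ρ α α0 : ℝ} (hρ : 0 ≤ ρ) (h : |α| ≤ α0) (h0 : α0 < Real.pi) :
    (1 + ρ) * Real.cos (α0 / 2) ≤ ‖1 + (ρ : ℂ) * Complex.exp (α * Complex.I)‖ := by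
  have h1 : (Complex.exp (((-α/2 : ℝ) : ℂ) * Complex.I) *
      (1 + (ρ : ℂ) * Complex.exp (α * Complex.I))).re = (1 + ρ) * Real.cos (α / 2) := by
    have : Complex.exp (((-α/2 : ℝ) : ℂ) * Complex.I) *
      (1 + (ρ : ℂ) * Complex.exp (α * Complex.I)) =
      Complex.exp (((-α/2 : ℝ) : ℂ) * Complex.I) + ρ * Complex.exp (((α/2 : ℝ) : ℂ) * Complex.I) := by
      rw [mul_add, mul_one, mul_left_comm, ← Complex.exp_add]
      congr 3
      push_cast; ring
    rw [this, Complex.add_re, Complex.re_ofReal_mul, Complex.exp_ofReal_mul_I_re,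
      Complex.exp_ofReal_mul_I_re, neg_div, Real.cos_neg]
    ring
  have h2 := Complex.re_le_norm (Complex.exp (((-α/2 : ℝ) : ℂ) * Complex.I) *
      (1 + (ρ : ℂ) * Complex.exp (α * Complex.I)))
  rw [h1, norm_mul, Complex.norm_exp_ofReal_mul_I, one_mul] at h2
  refine le_trans ?_ h2
  have : Real.cos (α0 / 2) ≤ Real.cos (α / 2) := by
    rw [← Real.cos_abs (α / 2)]
    apply Real.cos_le_cos_of_nonneg_of_le_pi (abs_nonneg _) (by linarith [abs_nonneg α])
    rw [abs_div, abs_two]; linarith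
  gcongr

lemma FV_cos_pos {α0 : ℝ} (h : 0 ≤ α0) (h0 : α0 < Real.pi) : 0 < Real.cos (α0 / 2) :=
  Real.cos_pos_of_mem_Ioo ⟨by linarith [Real.pi_pos], by linarith⟩

lemma FV_den_ne {ρ α : ℝ} (hρ : 0 ≤ ρ) (h : |α| < Real.pi) :
    1 + (ρ : ℂ) * Complex.exp (α * Complex.I) ≠ 0 := by
  have := FV_den hρ le_rfl h
  have h2 := FV_cos_pos (abs_nonneg α) h
  rw [← norm_pos_iff]
  exact lt_of_lt_of_le (by positivity) this

lemma FV_exp (c θ x y : ℝ) : (c : ℂ) * Complex.exp (θ * (x + y * Complex.I)) =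
    ((c * Real.exp (θ * x) : ℝ) : ℂ) * Complex.exp ((θ * y : ℝ) * Complex.I) := by
  push_cast
  rw [mul_assoc, ← Complex.exp_add]
  congr 2; ring

lemma FVH_norm_le {c θ r x y α0 : ℝ} (hc : 0 < c) (h : |θ * y| ≤ α0) (h0 : α0 < Real.pi) :
    ‖FVH c θ r (x + y * Complex.I)‖ ≤ c * Real.exp (θ * x) / (1 + c * Real.exp (θ * x)) /
      Real.cos (α0 / 2) * Real.exp (r * Real.exp x * Real.cos y) := by
  have h1 := FV_den (ρ := c * Real.exp (θ * x)) (by positivity) h h0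
  have h2 := FV_cos_pos (le_trans (abs_nonneg _) h) h0
  unfold FVH
  rw [norm_mul, norm_div, FV_exp, norm_mul, Complex.norm_exp_ofReal_mul_I, mul_one,
    Complex.norm_real, Real.norm_of_nonneg (by positivity), Complex.norm_exp, div_div]
  have : ((r : ℂ) * Complex.exp (x + y * Complex.I)).re = r * Real.exp x * Real.cos y := by
    rw [Complex.re_ofReal_mul, Complex.exp_re]; simp [mul_assoc]
  rw [this]
  gcongr

lemma FVH_cont {c θ r φ : ℝ} (hc : 0 < c) (h : |θ * φ| < Real.pi) :
    Continuous fun x : ℝ => FVH c θ r (x + φ * Complex.I) := by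
  unfold FVH
  have : ∀ x : ℝ, 1 + (c : ℂ) * Complex.exp (θ * (x + φ * Complex.I)) ≠ 0 := by
    intro x; rw [FV_exp]; exact FV_den_ne (by positivity) h
  fun_prop (disch := exact this)

lemma FVH_cont' {c θ r x φ φ' : ℝ} (hc : 0 < c) (h : ∀ y ∈ Set.uIcc φ φ', |θ * y| < Real.pi) :
    ContinuousOn (fun y : ℝ => FVH c θ r (x + y * Complex.I)) (Set.uIcc φ φ') := by
  unfold FVH
  have : ∀ y ∈ Set.uIcc φ φ', 1 + (c : ℂ) * Complex.exp (θ * (x + y * Complex.I)) ≠ 0 := by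
    intro y hy; rw [FV_exp]; exact FV_den_ne (by positivity) (h y hy)
  fun_prop (disch := exact this)

lemma FVH_rect {c θ r φ φ' : ℝ} (hc : 0 < c) (h : ∀ y ∈ Set.uIcc φ φ', |θ * y| < Real.pi)
    (a b : ℝ) :
    (∫ x in a..b, FVH c θ r (x + φ' * Complex.I)) = (∫ x in a..b, FVH c θ r (x + φ * Complex.I))
      + Complex.I * (∫ y in φ..φ', FVH c θ r (b + y * Complex.I))
      - Complex.I * (∫ y in φ..φ', FVH c θ r (a + y * Complex.I)) := by
  have := Complex.integral_boundary_rect_eq_zero_of_differentiableOn (FVH c θ r)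
    (a + φ * Complex.I) (b + φ' * Complex.I) ?_
  · simp at this
    linear_combination -this
  · unfold FVH
    intro w hw
    have hw2 : w.im ∈ Set.uIcc φ φ' := by
      have := hw.2; simpa using this
    have : 1 + (c : ℂ) * Complex.exp (θ * w) ≠ 0 := by
      rw [← Complex.re_add_im w, FV_exp]; exact FV_den_ne (by positivity) (h _ hw2)
    apply DifferentiableAt.differentiableWithinAt
    fun_prop (disch := exact this)

lemma FVH_vert_top {c θ r φ φ' α0 : ℝ} (hc : 0 < c) (h : ∀ y ∈ Set.uIcc φ φ', |θ * y| ≤ α0)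
    (h0 : α0 < Real.pi) (hr : ∀ y ∈ Set.uIcc φ φ', y ≠ φ' → r * Real.cos y < 0) :
    Tendsto (fun b : ℝ => ∫ y in φ..φ', FVH c θ r (b + y * Complex.I)) atTop (𝓝 0) := by
  have hα : 0 ≤ α0 := le_trans (abs_nonneg _) (h φ Set.left_mem_uIcc)
  have hcos := FV_cos_pos hα h0
  have key : ∀ b y : ℝ, |θ * y| ≤ α0 → ‖FVH c θ r (b + y * Complex.I)‖ ≤
      1 / Real.cos (α0 / 2) * Real.exp (r * Real.exp b * Real.cos y) := by
    intro b y hy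
    refine (FVH_norm_le hc hy h0).trans ?_
    gcongr
    rw [div_le_one (by positivity)]; linarith
  have hae : ∀ᵐ y : ℝ, y ≠ φ' := by
    simp [ae_iff, measure_singleton]
  have := intervalIntegral.tendsto_integral_filter_of_dominated_convergence (μ := volume)
    (l := (atTop : Filter ℝ)) (a := φ) (b := φ')
    (F := fun b y : ℝ => FVH c θ r (b + y * Complex.I)) (f := fun _ => (0 : ℂ))
    (fun _ => 1 / Real.cos (α0 / 2)) ?_ ?_ ?_ ?_
  · simpa using this
  · refine Eventually.of_forall fun b => ?_
    exact ((FVH_cont' hc fun y hy => (h y hy).trans_lt h0).mono Set.uIoc_subset_uIcc).aestronglyMeasurable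
      measurableSet_uIoc
  · refine Eventually.of_forall fun b => ?_
    filter_upwards [hae] with y hy hy2
    have hy2 := Set.uIoc_subset_uIcc hy2
    refine (key b y (h y hy2)).trans ?_
    refine mul_le_of_le_one_right (by positivity) ?_
    rw [Real.exp_le_one_iff]
    nlinarith [hr y hy2 hy, Real.exp_pos b]
  · simp
  · filter_upwards [hae] with y hy hy2
    have hy2 := Set.uIoc_subset_uIcc hy2
    refine squeeze_zero_norm (fun b => key b y (h y hy2)) ?_
    rw [← mul_zero (1 / Real.cos (α0 / 2))]
    refine Tendsto.const_mul _ (Real.tendsto_exp_atBot.comp ?_)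
    have : Tendsto (fun b => (r * Real.cos y) * Real.exp b) atTop atBot :=
      Real.tendsto_exp_atTop.const_mul_atTop_of_neg (hr y hy2 hy)
    refine this.congr fun b => by ring

lemma FVH_vert_bot {c θ r φ φ' α0 : ℝ} (hc : 0 < c) (hθ : 0 < θ)
    (h : ∀ y ∈ Set.uIcc φ φ', |θ * y| ≤ α0)
    (h0 : α0 < Real.pi) (hr : ∀ y ∈ Set.uIcc φ φ', r * Real.cos y ≤ 0) :
    Tendsto (fun b : ℝ => ∫ y in φ..φ', FVH c θ r (b + y * Complex.I)) atBot (𝓝 0) := by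
  have hα : 0 ≤ α0 := le_trans (abs_nonneg _) (h φ Set.left_mem_uIcc)
  have hcos := FV_cos_pos hα h0
  have key : ∀ b : ℝ, ∀ y ∈ Set.uIoc φ φ', ‖FVH c θ r (b + y * Complex.I)‖ ≤
      c * Real.exp (θ * b) / Real.cos (α0 / 2) := by
    intro b y hy
    have hy := Set.uIoc_subset_uIcc hy
    refine (FVH_norm_le hc (h y hy) h0).trans ?_
    have h1 : Real.exp (r * Real.exp b * Real.cos y) ≤ 1 := by
      rw [Real.exp_le_one_iff]
      nlinarith [hr y hy, Real.exp_pos b]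
    refine (mul_le_of_le_one_right (by positivity) h1).trans ?_
    gcongr
    refine div_le_self (by positivity) ?_
    have : 0 < c * Real.exp (θ * b) := by positivity
    linarith
  refine squeeze_zero_norm (fun b => intervalIntegral.norm_integral_le_of_norm_le_const (key b)) ?_
  have : Tendsto (fun b => c * Real.exp (θ * b) / Real.cos (α0 / 2) * |φ' - φ|) atBot
      (𝓝 (c * 0 / Real.cos (α0 / 2) * |φ' - φ|)) := by
    refine Tendsto.mul_const _ (Tendsto.div_const (Tendsto.const_mul _ ?_) _)
    exact Real.tendsto_exp_atBot.comp (tendsto_id.const_mul_atBot hθ)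
  simpa using this

lemma FV_image : Real.exp '' Set.univ = Set.Ioi 0 := by
  rw [Set.image_univ, Real.range_exp]

lemma FV_int_bound {θ a : ℝ} (hθ : 0 < θ) (ha : 0 < a) :
    Integrable fun x : ℝ => Real.exp (θ * x) * Real.exp (-a * Real.exp x) := by
  have h1 : IntegrableOn (fun t : ℝ => t ^ (θ - 1) * Real.exp (-a * t)) (Set.Ioi 0) := by
    have := integrableOn_rpow_mul_exp_neg_mul_rpow (s := θ - 1) (p := 1) (b := a)
      (by linarith) (by norm_num) ha
    simpa using this
  rw [← FV_image, integrableOn_image_iff_integrableOn_abs_deriv_smul MeasurableSet.univ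
    (fun x _ => (Real.hasDerivAt_exp x).hasDerivWithinAt) Real.exp_injective.injOn,
    integrableOn_univ] at h1
  refine h1.congr (Eventually.of_forall fun x => ?_)
  simp only [Real.abs_exp, smul_eq_mul]
  rw [← mul_assoc, ← Real.exp_mul, ← Real.exp_add]
  congr 2; ring

lemma FVH_integrable {c θ r φ : ℝ} (hc : 0 < c) (hθ : 0 < θ) (h : |θ * φ| < Real.pi)
    (hr : r * Real.cos φ < 0) : Integrable fun x : ℝ => FVH c θ r (x + φ * Complex.I) := by
  have hcos := FV_cos_pos (abs_nonneg (θ * φ)) h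
  refine Integrable.mono' ((FV_int_bound hθ (neg_pos.2 hr)).const_mul
    (c / Real.cos (|θ * φ| / 2))) (FVH_cont hc h).aestronglyMeasurable
    (Eventually.of_forall fun x => ?_)
  refine (FVH_norm_le hc le_rfl h).trans ?_
  have : c * Real.exp (θ * x) / (1 + c * Real.exp (θ * x)) ≤ c * Real.exp (θ * x) := by
    refine div_le_self (by positivity) ?_
    have : 0 < c * Real.exp (θ * x) := by positivity
    linarith
  calc _ ≤ c * Real.exp (θ * x) / Real.cos (|θ * φ| / 2) *
        Real.exp (r * Real.exp x * Real.cos φ) := by gcongr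
    _ = _ := by
      rw [show - -(r * Real.cos φ) * Real.exp x = r * Real.exp x * Real.cos φ by ring]
      ring

lemma FVg_cont {c θ r : ℝ} (hc : 0 < c) (hθ : 1 < θ) (hθ2 : θ < 2) : Continuous (FVg c θ r) := by
  unfold FVg
  have : ∀ s : ℝ, (c : ℂ) * Complex.exp (Complex.I * θ * Real.pi / 2) *
        ((|s| ^ θ : ℝ) : ℂ) + 1 ≠ 0 := by
    intro s
    have := FV_den_ne (ρ := c * |s| ^ θ) (α := θ * (Real.pi / 2)) (by positivity) (by
      rw [abs_of_pos (by positivity)]; nlinarith [Real.pi_pos])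
    intro h
    apply this
    rw [← h]
    push_cast
    rw [show Complex.I * θ * Real.pi / 2 = θ * (Real.pi / 2) * Complex.I by ring]
    ring
  have h1 : Continuous fun s : ℝ => |s| ^ (θ - 1) :=
    continuous_abs.rpow_const fun _ => Or.inr (by linarith)
  have h2 : Continuous fun s : ℝ => |s| ^ θ :=
    continuous_abs.rpow_const fun _ => Or.inr (by linarith)
  fun_prop (disch := exact this)

lemma FVg_exp (c θ r x : ℝ) : FVg c θ r (Real.exp x) * (Real.exp x : ℂ) =
    -Complex.I * FVH c θ r (x + ((Real.pi / 2 : ℝ) : ℂ) * Complex.I) := by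
  unfold FVg FVH
  have e0 : Complex.exp ((Real.pi / 2 : ℝ) * Complex.I) = Complex.I := by
    push_cast; exact Complex.exp_pi_div_two_mul_I
  have e1 : Complex.exp (Complex.I * (θ - 1) * Real.pi / 2) =
      -Complex.I * Complex.exp (Complex.I * θ * Real.pi / 2) := by
    rw [show Complex.I * ((θ : ℂ) - 1) * Real.pi / 2 =
      Complex.I * θ * Real.pi / 2 - (Real.pi / 2 : ℝ) * Complex.I by push_cast; ring,
      Complex.exp_sub, e0, div_eq_mul_inv, Complex.inv_I]
    ring
  have e2 : Complex.exp (θ * (x + ((Real.pi / 2 : ℝ) : ℂ) * Complex.I)) =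
      Complex.exp (Complex.I * θ * Real.pi / 2) * Complex.exp (θ * x) := by
    rw [← Complex.exp_add]; congr 1; push_cast; ring
  have e3 : Complex.exp (x + ((Real.pi / 2 : ℝ) : ℂ) * Complex.I) = Complex.I * Complex.exp x := by
    rw [Complex.exp_add, e0, mul_comm]
  have e4 : ((|Real.exp x| ^ θ : ℝ) : ℂ) = Complex.exp (θ * x) := by
    rw [Real.abs_exp, ← Real.exp_mul]; push_cast; congr 1; ring
  have e5 : ((|Real.exp x| ^ (θ - 1) : ℝ) : ℂ) * (Real.exp x : ℂ) = Complex.exp (θ * x) := by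
    rw [Real.abs_exp, ← Real.exp_mul]; push_cast
    rw [← Complex.exp_add]; congr 1; ring
  rw [e1, e2, e3, e4, Complex.ofReal_exp, ← e4] at *
  rw [← e5]
  rw [show (r : ℂ) * (Complex.I * Complex.exp x) = Complex.I * r * Complex.exp x by ring]
  push_cast
  ring

lemma FVg_subst {c θ r : ℝ} (hc : 0 < c) (hθ : 1 < θ) (hθ2 : θ < 2) (a b : ℝ) :
    ∫ s in (Real.exp a)..(Real.exp b), FVg c θ r s =
    -Complex.I * ∫ x in a..b, FVH c θ r (x + ((Real.pi / 2 : ℝ) : ℂ) * Complex.I) := by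
  rw [← intervalIntegral.integral_deriv_smul_comp (f := Real.exp) (f' := Real.exp)
    (g := FVg c θ r) (fun x _ => Real.hasDerivAt_exp x) Real.continuous_exp.continuousOn
    (FVg_cont hc hθ hθ2), ← intervalIntegral.integral_const_mul]
  refine intervalIntegral.integral_congr fun x _ => ?_
  simp only [Function.comp, Complex.real_smul]
  rw [mul_comm, FVg_exp]

lemma FV_rot {c θ r φ α0 : ℝ} (hc : 0 < c) (hθ : 1 < θ) (hθ2 : θ < 2)
    (h : ∀ y ∈ Set.uIcc φ (Real.pi / 2), |θ * y| ≤ α0) (h0 : α0 < Real.pi)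
    (hφ : φ ≠ Real.pi / 2)
    (hr : ∀ y ∈ Set.uIcc φ (Real.pi / 2), y ≠ Real.pi / 2 → r * Real.cos y < 0) :
    Tendsto (fun v => ∫ s in (0:ℝ)..v, FVg c θ r s) atTop
      (𝓝 (-Complex.I * ∫ x : ℝ, FVH c θ r (x + φ * Complex.I))) := by
  have hcont := FVg_cont (r := r) hc hθ hθ2
  have hint := FVH_integrable (r := r) (φ := φ) hc (by linarith)
    ((h _ Set.left_mem_uIcc).trans_lt h0) (hr _ Set.left_mem_uIcc hφ)
  have T1 : Tendsto (fun x : ℝ => ∫ t in (-x)..x, FVH c θ r (t + φ * Complex.I)) atTop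
      (𝓝 (∫ x : ℝ, FVH c θ r (x + φ * Complex.I))) :=
    intervalIntegral_tendsto_integral hint tendsto_neg_atTop_atBot tendsto_id
  have T2 := FVH_vert_top (r := r) hc h h0 hr
  have T3 := (FVH_vert_bot (r := r) hc (by linarith) h h0 (fun y hy => by
    by_cases hy2 : y = Real.pi / 2
    · simp [hy2]
    · exact (hr y hy hy2).le)).comp tendsto_neg_atTop_atBot
  have T4 : Tendsto (fun x : ℝ => ∫ s in (0:ℝ)..(Real.exp (-x)), FVg c θ r s) atTop (𝓝 0) := by
    have hc2 : Continuous fun v : ℝ => ∫ s in (0:ℝ)..v, FVg c θ r s :=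
      intervalIntegral.continuous_primitive (fun _ _ => hcont.intervalIntegrable _ _) 0
    have := (hc2.tendsto 0)
    rw [intervalIntegral.integral_same] at this
    exact this.comp (Real.tendsto_exp_neg_atTop_nhds_zero)
  have T5 : Tendsto (fun x : ℝ => ∫ s in (0:ℝ)..(Real.exp x), FVg c θ r s) atTop
      (𝓝 (-Complex.I * ∫ x : ℝ, FVH c θ r (x + φ * Complex.I))) := by
    have := T4.add (((T1.add (T2.const_mul Complex.I)).sub (T3.const_mul Complex.I)).const_mul (-Complex.I))
    simp only [mul_zero, add_zero, sub_zero, zero_add] at this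
    refine this.congr fun x => ?_
    simp only [Function.comp]
    rw [← FVH_rect hc (fun y hy => (h y hy).trans_lt h0), ← FVg_subst hc hθ hθ2]
    exact intervalIntegral.integral_add_adjacent_intervals (hcont.intervalIntegrable _ _)
      (hcont.intervalIntegrable _ _)
  refine (T5.comp Real.tendsto_log_atTop).congr' ?_
  filter_upwards [eventually_gt_atTop 0] with v hv
  simp [Real.exp_log hv]

lemma FV_split {c θ : ℝ} (hc : 0 < c) (hθ : 1 < θ) (hθ2 : θ < 2) {u v r : ℝ} (hu : 0 < u)
    (hv : 0 < v) : FVapprox c θ u v r = (1 / (2 * Real.pi)) *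
      ((∫ s in (0:ℝ)..v, FVg c θ r s) + (starRingEnd ℂ) (∫ s in (0:ℝ)..u, FVg c θ r s)) := by
  unfold FVapprox
  have hcont := FVg_cont (r := r) hc hθ hθ2
  set g : ℝ → ℂ := fun s => (c : ℂ) * Complex.exp (Complex.I * Real.sign s * (θ - 1) * Real.pi / 2) *
      ((|s| ^ (θ - 1) : ℝ) : ℂ) * Complex.exp (Complex.I * r * s) /
      ((c : ℂ) * Complex.exp (Complex.I * Real.sign s * θ * Real.pi / 2) *
        ((|s| ^ θ : ℝ) : ℂ) + 1) with hg
  have gpos : ∀ s, 0 < s → g s = FVg c θ r s := by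
    intro s hs
    simp [hg, FVg, Real.sign_of_pos hs]
  have gneg : ∀ s, s < 0 → g s = (starRingEnd ℂ) (FVg c θ r (-s)) := by
    intro s hs
    simp only [hg, FVg, Real.sign_of_neg hs, map_div₀, map_mul, map_add, map_one,
      Complex.conj_ofReal, ← Complex.exp_conj, Complex.conj_I, map_sub, abs_neg, map_ofNat]
    push_cast
    ring_nf
  have i1 : IntervalIntegrable g volume 0 v := by
    refine (hcont.intervalIntegrable 0 v).congr (fun s hs => ?_)
    rw [Set.uIoc_of_le hv.le] at hs
    exact (gpos s hs.1).symm
  have hae : ∀ᵐ y : ℝ, y ≠ 0 := by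
    simp [ae_iff, measure_singleton]
  have hcont2 : Continuous fun s : ℝ => (starRingEnd ℂ) (FVg c θ r (-s)) :=
    Complex.continuous_conj.comp (hcont.comp continuous_neg)
  have e2 : ∀ᵐ s : ℝ, s ∈ Set.uIoc (-u) 0 → g s = (starRingEnd ℂ) (FVg c θ r (-s)) := by
    filter_upwards [hae] with s hs hs2
    rw [Set.uIoc_of_le (by linarith)] at hs2
    exact gneg s (lt_of_le_of_ne hs2.2 hs)
  have i2 : IntervalIntegrable g volume (-u) 0 := by
    refine (hcont2.intervalIntegrable (-u) 0).congr_ae ?_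
    rw [Filter.EventuallyEq, ae_restrict_iff' measurableSet_uIoc]
    filter_upwards [e2] with s hs h
    exact (hs h).symm
  congr 1
  rw [← intervalIntegral.integral_add_adjacent_intervals i2 i1, add_comm]
  congr 1
  · refine intervalIntegral.integral_congr_ae (Eventually.of_forall fun s hs => ?_)
    rw [Set.uIoc_of_le hv.le] at hs
    exact gpos s hs.1
  · rw [intervalIntegral.integral_congr_ae e2,
      intervalIntegral.integral_comp_neg (fun s => (starRingEnd ℂ) (FVg c θ r s)), neg_zero, neg_neg,
      intervalIntegral.integral_of_le hu.le, intervalIntegral.integral_of_le hu.le, integral_conj]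

lemma FV_lim {c θ : ℝ} (hc : 0 < c) (hθ : 1 < θ) (hθ2 : θ < 2) {r : ℝ} {L : ℂ}
    (h : Tendsto (fun v => ∫ s in (0:ℝ)..v, FVg c θ r s) atTop (𝓝 L)) :
    Tendsto (fun p : ℝ × ℝ => FVapprox c θ p.1 p.2 r) (atTop ×ˢ atTop)
      (𝓝 ((1 / Real.pi * L.re : ℝ) : ℂ)) := by
  have h1 := ((h.comp tendsto_snd).add
    (((Complex.continuous_conj.tendsto L).comp h).comp tendsto_fst)).const_mul
    (1 / (2 * Real.pi) : ℂ)
  have h2 : (1 / (2 * Real.pi) : ℂ) * (L + (starRingEnd ℂ) L) = ((1 / Real.pi * L.re : ℝ) : ℂ) := by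
    rw [Complex.add_conj]; push_cast
    have : (Real.pi : ℂ) ≠ 0 := by exact_mod_cast Real.pi_ne_zero
    field_simp
  rw [← h2]
  refine Tendsto.congr' ?_ h1
  filter_upwards [(eventually_gt_atTop (0:ℝ)).prod_mk (eventually_gt_atTop (0:ℝ))] with p hp
  rw [FV_split hc hθ hθ2 hp.1 hp.2]
  rfl

noncomputable def FVD (c θ s : ℝ) : ℂ :=
  1 + ((c * s ^ θ : ℝ) : ℂ) * Complex.exp ((θ * (Real.pi / 2) : ℝ) * Complex.I)

lemma FVD_sin_pos {θ : ℝ} (hθ : 1 < θ) (hθ2 : θ < 2) : 0 < Real.sin (θ * (Real.pi / 2)) :=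
  Real.sin_pos_of_pos_of_lt_pi (by positivity) (by nlinarith [Real.pi_pos])

lemma FVg_re {c θ s : ℝ} (hs : 0 < s) :
    (FVg c θ 0 s).re = (((c * s ^ (θ - 1) : ℝ) : ℂ) *
      Complex.exp ((θ * (Real.pi / 2) : ℝ) * Complex.I) / FVD c θ s).im := by
  have e0 : Complex.exp ((Real.pi / 2 : ℝ) * Complex.I) = Complex.I := by
    push_cast; exact Complex.exp_pi_div_two_mul_I
  have e1 : Complex.exp (Complex.I * (θ - 1) * Real.pi / 2) =
      -Complex.I * Complex.exp ((θ * (Real.pi / 2) : ℝ) * Complex.I) := by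
    rw [show Complex.I * ((θ : ℂ) - 1) * Real.pi / 2 =
      (θ * (Real.pi / 2) : ℝ) * Complex.I - (Real.pi / 2 : ℝ) * Complex.I by push_cast; ring,
      Complex.exp_sub, e0, div_eq_mul_inv, Complex.inv_I]
    ring
  have : FVg c θ 0 s = -Complex.I * (((c * s ^ (θ - 1) : ℝ) : ℂ) *
      Complex.exp ((θ * (Real.pi / 2) : ℝ) * Complex.I) / FVD c θ s) := by
    unfold FVg FVD
    rw [e1, abs_of_pos hs, show Complex.I * θ * Real.pi / 2 =
      (θ * (Real.pi / 2) : ℝ) * Complex.I by push_cast; ring]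
    simp only [Complex.ofReal_zero, mul_zero, zero_mul, Complex.exp_zero]
    rw [Complex.ofReal_mul c, Complex.ofReal_mul c, add_comm (1 : ℂ), mul_right_comm (c : ℂ) _ (Complex.exp _)]
    ring
  rw [this]
  simp

lemma FVg_re_nonneg {c θ s : ℝ} (hc : 0 < c) (hθ : 1 < θ) (hθ2 : θ < 2) (hs : 0 < s) :
    0 ≤ (FVg c θ 0 s).re := by
  rw [FVg_re hs]
  set z : ℂ := ((c * s ^ (θ - 1) : ℝ) : ℂ) *
      Complex.exp ((θ * (Real.pi / 2) : ℝ) * Complex.I) with hz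
  have hD : FVD c θ s = 1 + s * z := by
    unfold FVD
    rw [hz, ← mul_assoc, ← Complex.ofReal_mul]
    congr 3
    rw [mul_left_comm, ← Real.rpow_one_add' hs.le (by linarith)]
    congr 2; ring
  have hzim : 0 ≤ z.im := by
    rw [hz, Complex.im_ofReal_mul, Complex.exp_ofReal_mul_I_im]
    have := FVD_sin_pos hθ hθ2
    positivity
  rw [hD, Complex.div_im, ← sub_div]
  refine div_nonneg ?_ (Complex.normSq_nonneg _)
  simp only [Complex.add_re, Complex.add_im, Complex.one_re, Complex.one_im,
    Complex.re_ofReal_mul, Complex.im_ofReal_mul]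
  ring_nf
  exact hzim

lemma FVD_im {c θ s : ℝ} : (FVD c θ s).im = c * s ^ θ * Real.sin (θ * (Real.pi / 2)) := by
  unfold FVD
  rw [Complex.add_im, Complex.im_ofReal_mul, Complex.exp_ofReal_mul_I_im]; simp

lemma FVD_deriv {c θ s : ℝ} (hc : 0 < c) (hθ : 1 < θ) (hθ2 : θ < 2) (hs : 0 < s) :
    HasDerivAt (fun s => 2 / θ * (Complex.log (FVD c θ s)).im) (2 * (FVg c θ 0 s).re) s := by
  have h1 : HasDerivAt (fun s : ℝ => c * s ^ θ) (c * (θ * s ^ (θ - 1))) s :=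
    (Real.hasDerivAt_rpow_const (Or.inl hs.ne')).const_mul c
  have h2 : HasDerivAt (FVD c θ) (((c * (θ * s ^ (θ - 1)) : ℝ) : ℂ) *
      Complex.exp ((θ * (Real.pi / 2) : ℝ) * Complex.I)) s :=
    (h1.ofReal_comp.mul_const _).const_add 1
  have h3 := h2.clog_real (by
    right; rw [FVD_im]; have := FVD_sin_pos hθ hθ2; positivity)
  have h4 := ((Complex.imCLM.hasFDerivAt.comp_hasDerivAt s h3).const_mul (2 / θ))
  refine h4.congr_deriv ?_
  rw [FVg_re hs]
  simp only [Complex.imCLM_apply]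
  rw [show (((c * (θ * s ^ (θ - 1)) : ℝ) : ℂ) *
      Complex.exp ((θ * (Real.pi / 2) : ℝ) * Complex.I)) / FVD c θ s = (θ : ℂ) *
      (((c * s ^ (θ - 1) : ℝ) : ℂ) *
      Complex.exp ((θ * (Real.pi / 2) : ℝ) * Complex.I) / FVD c θ s) by push_cast; ring,
      Complex.im_ofReal_mul]
  have : θ ≠ 0 := by linarith
  field_simp

lemma FVD_tendsto {c θ : ℝ} (hc : 0 < c) (hθ : 1 < θ) (hθ2 : θ < 2) :
    Tendsto (fun s => 2 / θ * (Complex.log (FVD c θ s)).im) atTop (𝓝 Real.pi) := by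
  have hsin := FVD_sin_pos hθ hθ2
  set w : ℂ := (c : ℂ) * Complex.exp ((θ * (Real.pi / 2) : ℝ) * Complex.I) with hw
  have hwim : w ∈ Complex.slitPlane := by
    right
    rw [hw, Complex.im_ofReal_mul, Complex.exp_ofReal_mul_I_im]
    positivity
  have hwarg : w.arg = θ * (Real.pi / 2) := by
    rw [hw, Complex.arg_real_mul _ hc, Complex.exp_mul_I,
      Complex.arg_cos_add_sin_mul_I ⟨by nlinarith [Real.pi_pos], by nlinarith [Real.pi_pos]⟩]
  have h1 : Tendsto (fun s : ℝ => ((s ^ (-θ) : ℝ) : ℂ) + w) atTop (𝓝 w) := by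
    have : Tendsto (fun s : ℝ => ((s ^ (-θ) : ℝ) : ℂ)) atTop (𝓝 ((0:ℝ):ℂ)) :=
      (Complex.continuous_ofReal.tendsto 0).comp (tendsto_rpow_neg_atTop (by linarith))
    simpa using this.add_const w
  have h2 := ((Complex.continuousAt_arg hwim).tendsto.comp h1).const_mul (2 / θ)
  rw [hwarg] at h2
  have h3 : 2 / θ * (θ * (Real.pi / 2)) = Real.pi := by
    have : θ ≠ 0 := by linarith
    field_simp
  rw [h3] at h2
  refine h2.congr' ?_
  filter_upwards [eventually_gt_atTop 0] with s hs
  rw [Complex.log_im]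
  simp only [Function.comp]
  have hp : 0 < s ^ θ := by positivity
  rw [← Complex.arg_real_mul _ hp]
  congr 2
  unfold FVD
  rw [hw, mul_add, ← Complex.ofReal_mul, ← Real.rpow_add hs]
  simp; ring

lemma FVk_cwa {c θ : ℝ} (hθ : 1 < θ) :
    ContinuousWithinAt (fun s => 2 / θ * (Complex.log (FVD c θ s)).im) (Set.Ici 0) 0 := by
  apply ContinuousAt.continuousWithinAt
  have h1 : ContinuousAt (FVD c θ) 0 := by
    unfold FVD
    have : ContinuousAt (fun s : ℝ => s ^ θ) 0 :=
      Real.continuousAt_rpow_const 0 θ (Or.inr (by linarith))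
    fun_prop
  have h2 : FVD c θ 0 ∈ Complex.slitPlane := by
    unfold FVD
    rw [Real.zero_rpow (by linarith)]; simp
  exact continuousAt_const.mul (Complex.continuous_im.continuousAt.comp (h1.clog h2))

lemma FVk_int {c θ : ℝ} (hc : 0 < c) (hθ : 1 < θ) (hθ2 : θ < 2) :
    IntegrableOn (fun s => 2 * (FVg c θ 0 s).re) (Set.Ioi 0) :=
  integrableOn_Ioi_deriv_of_nonneg (FVk_cwa hθ) (fun s hs => FVD_deriv hc hθ hθ2 hs)
    (fun s hs => mul_nonneg zero_le_two (FVg_re_nonneg hc hθ hθ2 hs)) (FVD_tendsto hc hθ hθ2)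

lemma FVk_integral {c θ : ℝ} (hc : 0 < c) (hθ : 1 < θ) (hθ2 : θ < 2) :
    ∫ s in Set.Ioi (0:ℝ), 2 * (FVg c θ 0 s).re = Real.pi := by
  rw [integral_Ioi_of_hasDerivAt_of_nonneg (FVk_cwa hθ) (fun s hs => FVD_deriv hc hθ hθ2 hs)
    (fun s hs => mul_nonneg zero_le_two (FVg_re_nonneg hc hθ hθ2 hs)) (FVD_tendsto hc hθ hθ2)]
  unfold FVD
  rw [Real.zero_rpow (by linarith)]; simp

lemma FVk_tendsto {c θ : ℝ} (hc : 0 < c) (hθ : 1 < θ) (hθ2 : θ < 2) :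
    Tendsto (fun r : ℝ => ∫ s in Set.Ioi (0:ℝ), 2 * (FVg c θ 0 s).re * Real.cos (r * s)) (𝓝 0)
      (𝓝 Real.pi) := by
  rw [← FVk_integral hc hθ hθ2]
  have hcont := FVg_cont (r := 0) hc hθ hθ2
  refine tendsto_integral_filter_of_dominated_convergence (fun s => ‖2 * (FVg c θ 0 s).re‖) ?_ ?_
    (FVk_int hc hθ hθ2).norm ?_
  · refine Eventually.of_forall fun r => Continuous.aestronglyMeasurable ?_
    have := Complex.continuous_re.comp hcont
    simp only [Function.comp_def] at this
    fun_prop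
  · refine Eventually.of_forall fun r => Eventually.of_forall fun s => ?_
    rw [norm_mul]
    exact mul_le_of_le_one_right (norm_nonneg _) (Real.abs_cos_le_one _)
  · refine Eventually.of_forall fun s => ?_
    have : Continuous fun r : ℝ => 2 * (FVg c θ 0 s).re * Real.cos (r * s) := by fun_prop
    simpa using this.tendsto 0

lemma FVg_cos (c θ r s : ℝ) : (FVg c θ r s + FVg c θ (-r) s).re =
    2 * (FVg c θ 0 s).re * Real.cos (r * s) := by
  have h : ∀ r : ℝ, FVg c θ r s = FVg c θ 0 s * Complex.exp ((r * s : ℝ) * Complex.I) := by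
    intro r
    unfold FVg
    rw [show Complex.I * r * s = (r * s : ℝ) * Complex.I by push_cast; ring]
    simp only [Complex.ofReal_zero, mul_zero, zero_mul, Complex.exp_zero]
    ring
  rw [h r, h (-r), ← mul_add, Complex.mul_re]
  simp only [Complex.add_re, Complex.add_im, Complex.exp_ofReal_mul_I_re,
    Complex.exp_ofReal_mul_I_im, neg_mul, Real.cos_neg, Real.sin_neg]
  ring

lemma FV_re_sum {c θ : ℝ} (hc : 0 < c) (hθ : 1 < θ) (hθ2 : θ < 2) {r : ℝ} {L L' : ℂ}
    (h : Tendsto (fun v => ∫ s in (0:ℝ)..v, FVg c θ r s) atTop (𝓝 L))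
    (h' : Tendsto (fun v => ∫ s in (0:ℝ)..v, FVg c θ (-r) s) atTop (𝓝 L')) :
    (L + L').re = ∫ s in Set.Ioi (0:ℝ), 2 * (FVg c θ 0 s).re * Real.cos (r * s) := by
  have hc0 := FVg_cont (r := 0) hc hθ hθ2
  have hc1 := FVg_cont (r := r) hc hθ hθ2
  have hc2 := FVg_cont (r := -r) hc hθ hθ2
  have h1 := (Complex.continuous_re.tendsto _).comp (h.add h')
  have hi : IntegrableOn (fun s => 2 * (FVg c θ 0 s).re * Real.cos (r * s)) (Set.Ioi 0) := by
    refine Integrable.mono (FVk_int hc hθ hθ2) (Continuous.aestronglyMeasurable ?_)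
      (Eventually.of_forall fun s => ?_)
    · have := Complex.continuous_re.comp hc0
      simp only [Function.comp_def] at this
      fun_prop
    · rw [norm_mul]
      exact mul_le_of_le_one_right (norm_nonneg _) (Real.abs_cos_le_one _)
  have h2 := intervalIntegral_tendsto_integral_Ioi 0 hi tendsto_id
  refine tendsto_nhds_unique h1 (h2.congr fun v => ?_)
  simp only [Function.comp, id]
  rw [← intervalIntegral.integral_add (hc1.intervalIntegrable _ _) (hc2.intervalIntegrable _ _)]
  have := Complex.reCLM.intervalIntegral_comp_comm
    ((hc1.add hc2).intervalIntegrable (μ := volume) 0 v)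
  simp only [Complex.reCLM_apply, Pi.add_apply] at this
  rw [← this]
  refine intervalIntegral.integral_congr fun s _ => (FVg_cos c θ r s).symm

lemma FVH_shift {c θ r : ℝ} (hr : 0 < r) (x φ : ℝ) :
    FVH c θ r (((x - Real.log r : ℝ) : ℂ) + φ * Complex.I) =
      FVH (c * r ^ (-θ)) θ 1 (x + φ * Complex.I) := by
  unfold FVH
  have e1 : (c : ℂ) * Complex.exp (θ * (((x - Real.log r : ℝ) : ℂ) + φ * Complex.I)) =
      ((c * r ^ (-θ) : ℝ) : ℂ) * Complex.exp (θ * (x + φ * Complex.I)) := by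
    rw [Real.rpow_def_of_pos hr]
    push_cast
    rw [mul_assoc, ← Complex.exp_add]
    congr 2; ring
  have e2 : (r : ℂ) * Complex.exp (((x - Real.log r : ℝ) : ℂ) + φ * Complex.I) =
      ((1 : ℝ) : ℂ) * Complex.exp (x + φ * Complex.I) := by
    nth_rewrite 1 [← Real.exp_log hr]
    push_cast
    rw [← Complex.exp_add, one_mul]
    congr 1; ring
  rw [e1, e2]

lemma FVE_norm (θ x y : ℝ) : ‖Complex.exp (θ * (x + y * Complex.I)) *
    Complex.exp (Complex.exp (x + y * Complex.I))‖ =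
    Real.exp (θ * x) * Real.exp (Real.exp x * Real.cos y) := by
  rw [norm_mul, Complex.norm_exp, Complex.norm_exp, Complex.re_ofReal_mul, Complex.exp_re]
  simp

lemma FVE_vert {θ φ : ℝ} (hcos : Real.cos φ < 0) (h1 : Real.pi / 2 < φ) (h2 : φ < Real.pi)
    {l : Filter ℝ} (hl : Tendsto (fun x => Real.exp (θ * x) * Real.exp (Real.exp x * Real.cos φ)) l
      (𝓝 0)) :
    Tendsto (fun x : ℝ => ∫ y in φ..Real.pi, Complex.exp (θ * (x + y * Complex.I)) *
      Complex.exp (Complex.exp (x + y * Complex.I))) l (𝓝 0) := by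
  refine squeeze_zero_norm (fun x => intervalIntegral.norm_integral_le_of_norm_le_const
    (C := Real.exp (θ * x) * Real.exp (Real.exp x * Real.cos φ)) fun y hy => ?_) ?_
  · rw [FVE_norm]
    rw [Set.uIoc_of_le h2.le] at hy
    have : Real.cos y ≤ Real.cos φ :=
      Real.cos_le_cos_of_nonneg_of_le_pi (by linarith [Real.pi_pos]) hy.2 hy.1.le
    gcongr
  · simpa using hl.mul_const |Real.pi - φ|

lemma FVE_integrable {θ y : ℝ} (hθ : 0 < θ) (hy : Real.cos y < 0) :
    Integrable fun x : ℝ => Complex.exp (θ * (x + y * Complex.I)) *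
      Complex.exp (Complex.exp (x + y * Complex.I)) := by
  refine (FV_int_bound hθ (neg_pos.2 hy)).mono' (by fun_prop) (Eventually.of_forall fun x => ?_)
  rw [FVE_norm, neg_neg, mul_comm (Real.cos y)]

lemma FVE_real {θ : ℝ} (hθ : 0 < θ) :
    ∫ x : ℝ, Real.exp (θ * x) * Real.exp (-Real.exp x) = Real.Gamma θ := by
  rw [Real.Gamma_eq_integral hθ, ← FV_image,
    integral_image_eq_integral_abs_deriv_smul MeasurableSet.univ
    (fun x _ => (Real.hasDerivAt_exp x).hasDerivWithinAt) Real.exp_injective.injOn,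
    setIntegral_univ]
  congr 1
  ext x
  rw [Real.abs_exp, ← Real.exp_mul, smul_eq_mul, ← Real.exp_add, ← Real.exp_add, ← Real.exp_add]
  congr 1; ring

lemma FV_gamma {θ φ : ℝ} (hθ : 1 < θ) (h1 : Real.pi / 2 < φ) (h2 : φ < Real.pi) :
    ∫ x : ℝ, Complex.exp (θ * (x + φ * Complex.I)) * Complex.exp (Complex.exp (x + φ * Complex.I)) =
      Real.Gamma θ * Complex.exp ((Real.pi * θ : ℝ) * Complex.I) := by
  have hcos : Real.cos φ < 0 := Real.cos_neg_of_pi_div_two_lt_of_lt h1 (by linarith)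
  have hθ0 : 0 < θ := by linarith
  have b0 : Tendsto (fun x => Real.exp (θ * x) * Real.exp (Real.exp x * Real.cos φ)) atBot
      (𝓝 0) := by
    have t1 : Tendsto (fun x : ℝ => Real.exp (θ * x)) atBot (𝓝 0) :=
      Real.tendsto_exp_atBot.comp (tendsto_id.const_mul_atBot hθ0)
    have t2 : Tendsto (fun x : ℝ => Real.exp (Real.exp x * Real.cos φ)) atBot
        (𝓝 (Real.exp (0 * Real.cos φ))) :=
      (Real.continuous_exp.tendsto _).comp (Real.tendsto_exp_atBot.mul_const _)
    simpa using t1.mul t2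
  have t0 : Tendsto (fun x => Real.exp (θ * x) * Real.exp (Real.exp x * Real.cos φ)) atTop
      (𝓝 0) := by
    have t1 := (tendsto_rpow_mul_exp_neg_mul_atTop_nhds_zero θ (-Real.cos φ)
      (neg_pos.2 hcos)).comp Real.tendsto_exp_atTop
    refine t1.congr fun x => ?_
    simp only [Function.comp]
    rw [← Real.exp_mul, neg_neg, mul_comm x, mul_comm (Real.cos φ)]
  have V1 := FVE_vert hcos h1 h2 t0
  have V2 := (FVE_vert hcos h1 h2 b0).comp tendsto_neg_atTop_atBot
  have I1 := intervalIntegral_tendsto_integral (FVE_integrable hθ0 hcos) tendsto_neg_atTop_atBot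
    (tendsto_id (α := ℝ))
  have I2 := intervalIntegral_tendsto_integral (FVE_integrable (y := Real.pi) hθ0 (by simp))
    tendsto_neg_atTop_atBot (tendsto_id (α := ℝ))
  have R : ∀ b : ℝ, _ := fun b => Complex.integral_boundary_rect_eq_zero_of_differentiableOn
    (fun w => Complex.exp (θ * w) * Complex.exp (Complex.exp w))
    (((-b : ℝ) : ℂ) + φ * Complex.I) (b + Real.pi * Complex.I) (by fun_prop)
  have S := ((I1.sub I2).add (V1.const_mul Complex.I)).sub (V2.const_mul Complex.I)
  have S2 := tendsto_nhds_unique S (tendsto_const_nhds.congr fun b => by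
    have := R b
    simp only [Complex.add_re, Complex.add_im, Complex.ofReal_re, Complex.ofReal_im,
      Complex.mul_re, Complex.mul_im, Complex.I_re, Complex.I_im, mul_zero, mul_one, sub_zero,
      add_zero, zero_add, sub_self, smul_eq_mul] at this
    exact this.symm)
  simp only [mul_zero, add_zero, sub_zero] at S2
  rw [sub_eq_zero.1 S2, ← FVE_real hθ0, ← integral_complex_ofReal, ← integral_mul_const]
  congr 1
  ext x
  rw [Complex.exp_add (x : ℂ), Complex.exp_pi_mul_I, mul_add, Complex.exp_add]
  push_cast
  rw [mul_neg_one, show (θ : ℂ) * (Real.pi * Complex.I) = Real.pi * θ * Complex.I by ring]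
  ring

lemma FV_asym {c θ φ : ℝ} (hc : 0 < c) (hθ : 1 < θ) (hφ : |θ * φ| < Real.pi)
    (h1 : Real.pi / 2 < φ) (h2 : φ < Real.pi) :
    Tendsto (fun r : ℝ => ((r ^ θ : ℝ) : ℂ) * ∫ x : ℝ, FVH c θ r (x + φ * Complex.I)) atTop
      (𝓝 (c * (Real.Gamma θ * Complex.exp ((Real.pi * θ : ℝ) * Complex.I)))) := by
  have hcos : Real.cos φ < 0 := Real.cos_neg_of_pi_div_two_lt_of_lt h1 (by linarith)
  have hcos2 := FV_cos_pos (abs_nonneg (θ * φ)) hφ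
  rw [← FV_gamma hθ h1 h2, ← integral_const_mul]
  have key := tendsto_integral_filter_of_dominated_convergence (μ := volume)
    (l := (atTop : Filter ℝ))
    (F := fun r x : ℝ => ((r ^ θ : ℝ) : ℂ) * FVH (c * r ^ (-θ)) θ 1 (x + φ * Complex.I))
    (f := fun x : ℝ => (c : ℂ) * (Complex.exp (θ * (x + φ * Complex.I)) *
      Complex.exp (Complex.exp (x + φ * Complex.I))))
    (fun x => (c / Real.cos (|θ * φ| / 2)) *
      (Real.exp (θ * x) * Real.exp (-(-Real.cos φ) * Real.exp x))) ?_ ?_ ?_ ?_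
  · refine key.congr' ?_
    filter_upwards [eventually_gt_atTop 0] with r hr
    rw [integral_const_mul]
    congr 1
    simp_rw [← FVH_shift hr]
    exact integral_sub_right_eq_self (fun x : ℝ => FVH c θ r (x + φ * Complex.I)) (Real.log r)
  · filter_upwards [eventually_gt_atTop 0] with r hr
    exact (continuous_const.mul (FVH_cont (by positivity) hφ)).aestronglyMeasurable
  · filter_upwards [eventually_gt_atTop 0] with r hr
    refine Eventually.of_forall fun x => ?_
    have hc' : 0 < c * r ^ (-θ) := by positivity
    have hb := FVH_norm_le (θ := θ) (r := 1) (x := x) hc' le_rfl hφ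
    rw [norm_mul, Complex.norm_real, Real.norm_of_nonneg (by positivity)]
    have h3 : c * r ^ (-θ) * Real.exp (θ * x) / (1 + c * r ^ (-θ) * Real.exp (θ * x)) ≤
        c * r ^ (-θ) * Real.exp (θ * x) := by
      refine div_le_self (by positivity) ?_
      have : 0 < c * r ^ (-θ) * Real.exp (θ * x) := by positivity
      linarith
    have h4 : r ^ θ * r ^ (-θ) = 1 := by rw [← Real.rpow_add hr]; simp
    calc _ ≤ r ^ θ * (c * r ^ (-θ) * Real.exp (θ * x) / Real.cos (|θ * φ| / 2) *
          Real.exp (1 * Real.exp x * Real.cos φ)) := by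
          gcongr
          exact hb.trans (by gcongr)
      _ = (r ^ θ * r ^ (-θ)) * ((c / Real.cos (|θ * φ| / 2)) *
          (Real.exp (θ * x) * Real.exp (1 * Real.exp x * Real.cos φ))) := by ring
      _ = _ := by rw [h4, one_mul]; congr 3; ring
  · exact (FV_int_bound (by linarith) (neg_pos.2 hcos)).const_mul _
  · refine Eventually.of_forall fun x => ?_
    set E := Complex.exp (θ * (x + φ * Complex.I))
    set X := Complex.exp (Complex.exp (x + φ * Complex.I)) with hX
    have t1 : Tendsto (fun r : ℝ => ((c * r ^ (-θ) : ℝ) : ℂ)) atTop (𝓝 ((c * 0 : ℝ) : ℂ)) :=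
      (Complex.continuous_ofReal.tendsto _).comp
        ((tendsto_rpow_neg_atTop (by linarith)).const_mul c)
    have t2 : Tendsto (fun r : ℝ => c * E / (1 + ((c * r ^ (-θ) : ℝ) : ℂ) * E) * X) atTop
        (𝓝 (c * E / (1 + ((c * 0 : ℝ) : ℂ) * E) * X)) :=
      (tendsto_const_nhds.div ((t1.mul_const E).const_add 1) (by simp)).mul_const X
    rw [show (c : ℂ) * E / (1 + ((c * 0 : ℝ) : ℂ) * E) * X = c * (E * X) by simp; ring] at t2
    refine t2.congr' ?_
    filter_upwards [eventually_gt_atTop 0] with r hr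
    have h4 : ((r ^ θ : ℝ) : ℂ) * ((r ^ (-θ) : ℝ) : ℂ) = 1 := by
      rw [← Complex.ofReal_mul, ← Real.rpow_add hr]; simp
    simp only [FVH, Complex.ofReal_one, one_mul]
    rw [← mul_assoc, ← hX]
    congr 1
    rw [← mul_div_assoc, ← mul_assoc]
    congr 2
    rw [Complex.ofReal_mul, mul_left_comm, h4, mul_one]

theorem stmt17 (c θ : ℝ) (hc : 0 < c) (hθ1 : 1 < θ) (hθ2 : θ < 2) :
    ∃ FV : ℝ → ℝ,
      (∀ r : ℝ, r ≠ 0 →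
        Tendsto (fun p : ℝ × ℝ => FVapprox c θ p.1 p.2 r) (atTop ×ˢ atTop)
          (𝓝 ((FV r : ℝ) : ℂ))) ∧
      (∀ r : ℝ, r < 0 → FV r = 0) ∧
      Tendsto FV (𝓝[>] 0) (𝓝 1) ∧
      Tendsto (fun r : ℝ => FV r / ((c / Real.Gamma (1 - θ)) * r ^ (-θ))) atTop (𝓝 1) := by
  have hpi := Real.pi_pos
  have hθ0 : 0 < θ := by linarith
  obtain ⟨φ, hφ1, hφ2⟩ : ∃ φ, Real.pi / 2 < φ ∧ φ < Real.pi / θ :=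
    exists_between (div_lt_div_of_pos_left hpi hθ0 hθ2)
  have hφθ : θ * φ < Real.pi := by rwa [lt_div_iff₀ hθ0, mul_comm] at hφ2
  have hφpi : φ < Real.pi := hφ2.trans (div_lt_self hpi hθ1)
  have hφθ' : |θ * φ| < Real.pi := by rwa [abs_of_pos (mul_pos hθ0 (by linarith))]
  -- rotation for negative `r`
  have neg : ∀ r : ℝ, r < 0 → Tendsto (fun v => ∫ s in (0:ℝ)..v, FVg c θ r s) atTop
      (𝓝 (-Complex.I * ∫ x : ℝ, FVH c θ r (x + (0:ℝ) * Complex.I))) := by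
    intro r hr
    refine FV_rot (α0 := θ * (Real.pi / 2)) hc hθ1 hθ2 ?_ (by nlinarith) (by positivity) ?_
    · intro y hy
      rw [Set.uIcc_of_le (by positivity)] at hy
      rw [abs_of_nonneg (mul_nonneg hθ0.le hy.1)]
      exact mul_le_mul_of_nonneg_left hy.2 hθ0.le
    · intro y hy hy2
      rw [Set.uIcc_of_le (by positivity)] at hy
      have : 0 < Real.cos y :=
        Real.cos_pos_of_mem_Ioo ⟨by linarith [hy.1], lt_of_le_of_ne hy.2 hy2⟩
      nlinarith
  have pos : ∀ r : ℝ, 0 < r → Tendsto (fun v => ∫ s in (0:ℝ)..v, FVg c θ r s) atTop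
      (𝓝 (-Complex.I * ∫ x : ℝ, FVH c θ r (x + φ * Complex.I))) := by
    intro r hr
    refine FV_rot (α0 := θ * φ) hc hθ1 hθ2 ?_ hφθ hφ1.ne' ?_
    · intro y hy
      rw [Set.uIcc_of_ge hφ1.le] at hy
      rw [abs_of_nonneg (mul_nonneg hθ0.le (by linarith [hy.1]))]
      exact mul_le_mul_of_nonneg_left hy.2 hθ0.le
    · intro y hy hy2
      rw [Set.uIcc_of_ge hφ1.le] at hy
      have : Real.cos y < 0 :=
        Real.cos_neg_of_pi_div_two_lt_of_lt (lt_of_le_of_ne hy.1 (Ne.symm hy2))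
          (by linarith [hy.2])
      nlinarith
  have negre : ∀ r : ℝ, (-Complex.I * ∫ x : ℝ, FVH c θ r (x + (0:ℝ) * Complex.I)).re = 0 := by
    intro r
    have : ∀ x : ℝ, FVH c θ r (x + (0:ℝ) * Complex.I) =
        ((c * Real.exp (θ * x) / (1 + c * Real.exp (θ * x)) * Real.exp (r * Real.exp x) : ℝ) : ℂ) := by
      intro x; unfold FVH; push_cast; simp
    simp_rw [this]
    rw [integral_complex_ofReal]
    simp
  refine ⟨fun r => if r < 0 then 0 else
    1 / Real.pi * (-Complex.I * ∫ x : ℝ, FVH c θ r (x + φ * Complex.I)).re, ?_, ?_, ?_, ?_⟩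
  · intro r hr
    rcases lt_or_gt_of_ne hr with h | h
    · have := FV_lim hc hθ1 hθ2 (neg r h)
      rw [negre, mul_zero] at this
      simpa only [if_pos h] using this
    · simpa only [if_neg h.not_gt] using FV_lim hc hθ1 hθ2 (pos r h)
  · intro r hr
    simp only [if_pos hr]
  · have h1 := ((FVk_tendsto hc hθ1 hθ2).mono_left (nhdsWithin_le_nhds (s := Set.Ioi 0))).const_mul
      (1 / Real.pi)
    rw [one_div_mul_cancel hpi.ne'] at h1
    refine h1.congr' ?_
    filter_upwards [self_mem_nhdsWithin] with r hr
    have hr : 0 < r := hr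
    rw [if_neg hr.not_gt, ← FV_re_sum hc hθ1 hθ2 (pos r hr) (neg (-r) (by linarith)),
      Complex.add_re, negre, add_zero]
  · have h1 := (Complex.continuous_re.tendsto _).comp
      ((FV_asym hc hθ1 hφθ' hφ1 hφpi).const_mul (-Complex.I))
    have hG := Real.Gamma_mul_Gamma_one_sub θ
    have hsin : Real.sin (Real.pi * θ) ≠ 0 := by
      have : Real.sin (Real.pi * θ) = - Real.sin (Real.pi * θ - Real.pi) := by
        rw [Real.sin_sub_pi, neg_neg]
      rw [this, neg_ne_zero]
      exact (Real.sin_pos_of_pos_of_lt_pi (by nlinarith) (by nlinarith)).ne'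
    have hGθ : Real.Gamma θ ≠ 0 := (Real.Gamma_pos_of_pos hθ0).ne'
    have hG1 : Real.Gamma (1 - θ) ≠ 0 := by
      intro h0
      rw [h0, mul_zero] at hG
      exact (div_ne_zero hpi.ne' hsin) hG.symm
    have hval : (-Complex.I * (c * (Real.Gamma θ *
        Complex.exp ((Real.pi * θ : ℝ) * Complex.I)))).re =
        c * Real.Gamma θ * Real.sin (Real.pi * θ) := by
      rw [← mul_assoc (c : ℂ), ← Complex.ofReal_mul, mul_left_comm, Complex.re_ofReal_mul]
      simp [Complex.exp_ofReal_mul_I_im, -Complex.ofReal_mul]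
    rw [hval] at h1
    have h2 := h1.const_mul (Real.Gamma (1 - θ) / (Real.pi * c))
    have h3 : Real.Gamma (1 - θ) / (Real.pi * c) * (c * Real.Gamma θ * Real.sin (Real.pi * θ)) = 1 := by
      rw [eq_div_iff hsin] at hG
      rw [div_mul_eq_mul_div, div_eq_one_iff_eq (by positivity)]
      linear_combination c * hG
    rw [h3] at h2
    refine h2.congr' ?_
    filter_upwards [eventually_gt_atTop 0] with r hr
    rw [if_neg hr.not_gt]
    simp only [Function.comp]
    rw [mul_left_comm, Complex.re_ofReal_mul, Real.rpow_neg hr.le]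
    have := hc.ne'
    have : r ^ θ ≠ 0 := by positivity
    field_simp
end

section
/- The integral ∫_0^∞ r^{θζ−1}·F_V(r)² dr is finite, and lim_{t→∞} t^{θζ}·Σ_{k=1}^∞ w_k·F_V(t·λ_k^{1/θ})² = Q·θζ·∫_0^∞ r^{θζ−1}·F_V(r)² dr, where the limit is taken over integers t → ∞. -/
open Filter Topology MeasureTheory

noncomputable def mfun (c θ : ℝ) (w : ℂ) : ℂ :=
  (c : ℂ) * Complex.exp (θ * w) / ((c : ℂ) * Complex.exp (θ * w) + 1)

noncomputable def Hfun (c θ r : ℝ) (w : ℂ) : ℂ :=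
  mfun c θ w * Complex.exp (r * Complex.exp w)

lemma mfun_bound (c θ φ : ℝ) (hc : 0 < c) (hθ1 : 1 < θ) (hφ1 : Real.pi / 2 < φ)
    (hφ2 : θ * φ < Real.pi) :
    ∃ K : ℝ, 0 < K ∧ ∀ w : ℂ, 0 ≤ w.im → w.im ≤ φ →
      ((c : ℂ) * Complex.exp (θ * w) + 1 ≠ 0) ∧
      ∀ a : ℝ, 0 ≤ a → a ≤ θ → ‖mfun c θ w‖ ≤ K * Real.exp (a * w.re) := by
  have hpi := Real.pi_pos
  have hcosle : Real.cos (θ * φ) ≤ 0 :=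
    Real.cos_nonpos_of_pi_div_two_le_of_le (by nlinarith) (by linarith)
  have hcosgt : -1 < Real.cos (θ * φ) := by
    have := Real.cos_lt_cos_of_nonneg_of_le_pi (x := θ * φ) (y := Real.pi) (by nlinarith) le_rfl hφ2
    simpa using this
  set δ := 1 + Real.cos (θ * φ) with hδ
  have hδ0 : 0 < δ := by linarith
  have hd : 0 < Real.sqrt δ := Real.sqrt_pos.2 hδ0
  refine ⟨max 1 c / Real.sqrt δ, by positivity, ?_⟩
  intro w h0 h1
  set z := (c : ℂ) * Complex.exp (θ * w) with hz
  set ρ := c * Real.exp (θ * w.re) with hρ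
  have hρ0 : 0 < ρ := by positivity
  have hzn : ‖z‖ = ρ := by
    rw [hz, norm_mul, Complex.norm_exp, Complex.norm_real, Real.norm_of_nonneg hc.le]
    simp [hρ]
  have hzre : z.re = ρ * Real.cos (θ * w.im) := by
    rw [hz, Complex.re_ofReal_mul, Complex.exp_re]
    simp [hρ, mul_assoc]
  have hcos : Real.cos (θ * φ) ≤ Real.cos (θ * w.im) :=
    Real.cos_le_cos_of_nonneg_of_le_pi (by positivity) hφ2.le (by nlinarith)
  have hsq : ‖z + 1‖ ^ 2 = 1 + ρ ^ 2 + 2 * ρ * Real.cos (θ * w.im) := by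
    have h2 : ‖z‖ ^ 2 = z.re ^ 2 + z.im ^ 2 := by
      rw [Complex.sq_norm, Complex.normSq_apply]; ring
    rw [Complex.sq_norm, Complex.normSq_apply]
    simp only [Complex.add_re, Complex.one_re, Complex.add_im, Complex.one_im]
    rw [hzn] at h2
    nlinarith
  have hge : δ * (1 + ρ ^ 2) ≤ ‖z + 1‖ ^ 2 := by
    rw [hsq]
    nlinarith [mul_nonneg (by linarith : 0 ≤ 1 - δ) (sq_nonneg (1 - ρ)),
      mul_le_mul_of_nonneg_left hcos hρ0.le]
  have hn1 : Real.sqrt δ ≤ ‖z + 1‖ := by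
    apply Real.sqrt_le_iff.2 ⟨norm_nonneg _, by nlinarith [mul_nonneg hδ0.le (sq_nonneg ρ)]⟩
  have hn2 : Real.sqrt δ * ρ ≤ ‖z + 1‖ := by
    apply (sq_le_sq₀ (by positivity) (norm_nonneg _)).1
    rw [mul_pow, Real.sq_sqrt hδ0.le]
    nlinarith
  have hpos : 0 < ‖z + 1‖ := lt_of_lt_of_le hd hn1
  refine ⟨norm_pos_iff.1 hpos, ?_⟩
  intro a ha0 haθ
  have hm : ‖mfun c θ w‖ = ρ / ‖z + 1‖ := by
    rw [mfun, norm_div, ← hz, hzn]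
  rw [hm, div_le_iff₀ hpos]
  have key : ρ ≤ max 1 c / Real.sqrt δ * Real.exp (a * w.re) * ‖z+1‖ := by
    rw [div_mul_eq_mul_div, div_mul_eq_mul_div, le_div_iff₀ hd]
    rcases le_total 0 w.re with h | h
    · have e1 : 1 ≤ Real.exp (a * w.re) := Real.one_le_exp (by positivity)
      have e2 : 1 ≤ max 1 c * Real.exp (a * w.re) :=
        one_le_mul_of_one_le_of_one_le (le_max_left _ _) e1
      nlinarith
    · have e1 : Real.exp (θ * w.re) ≤ Real.exp (a * w.re) :=
        Real.exp_le_exp.2 (mul_le_mul_of_nonpos_right haθ h)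
      have e2 : ρ ≤ max 1 c * Real.exp (a * w.re) :=
        mul_le_mul (le_max_right _ _) e1 (Real.exp_pos _).le (by positivity)
      exact mul_le_mul e2 hn1 hd.le (by positivity)
  exact key

lemma mfun_diffAt (c θ : ℝ) (w : ℂ) (h : (c : ℂ) * Complex.exp (θ * w) + 1 ≠ 0) :
    DifferentiableAt ℂ (mfun c θ) w := by
  unfold mfun
  exact DifferentiableAt.div (c := fun w : ℂ => (c : ℂ) * Complex.exp (θ * w))
    (d := fun w : ℂ => (c : ℂ) * Complex.exp (θ * w) + 1) (by fun_prop) (by fun_prop) h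

lemma Hfun_diffAt (c θ r : ℝ) (w : ℂ) (h : (c : ℂ) * Complex.exp (θ * w) + 1 ≠ 0) :
    DifferentiableAt ℂ (Hfun c θ r) w := by
  unfold Hfun
  apply (mfun_diffAt c θ w h).mul
  fun_prop

lemma norm_exp_exp (r x y : ℝ) :
    ‖Complex.exp (r * Complex.exp ((x : ℂ) + y * Complex.I))‖ =
      Real.exp (r * (Real.exp x * Real.cos y)) := by
  rw [Complex.norm_exp, Complex.re_ofReal_mul, Complex.exp_re]
  simp

lemma integrable_exp_exp (a b : ℝ) (ha : 0 < a) (hb : 0 < b) :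
    Integrable (fun x : ℝ => Real.exp (a * x) * Real.exp (-(b * Real.exp x))) := by
  have h := integrableOn_rpow_mul_exp_neg_mul_rpow (p := 1) (s := a - 1) (b := b)
    (by linarith) one_pos hb
  have him : Real.exp '' Set.univ = Set.Ioi 0 := by simp
  rw [← him, integrableOn_image_iff_integrableOn_abs_deriv_smul (f' := Real.exp) MeasurableSet.univ
    (fun x _ => (Real.hasDerivAt_exp x).hasDerivWithinAt) Real.exp_injective.injOn,
    integrableOn_univ] at h
  refine h.congr (ae_of_all _ fun x => ?_)
  simp only [abs_of_pos (Real.exp_pos x), smul_eq_mul, Real.rpow_one]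
  rw [← Real.exp_mul, ← mul_assoc, ← Real.exp_add]
  congr 2 <;> ring_nf

lemma integral_exp_exp (a b r : ℝ) (hr : 0 < r) :
    ∫ x : ℝ, Real.exp (a * x) * Real.exp (-(r * b * Real.exp x)) =
      r ^ (-a) * ∫ x : ℝ, Real.exp (a * x) * Real.exp (-(b * Real.exp x)) := by
  rw [← integral_add_right_eq_self (fun x : ℝ => Real.exp (a * x) * Real.exp (-(b * Real.exp x)))
    (Real.log r), ← integral_const_mul]
  congr 1
  ext x
  rw [Real.exp_add, Real.exp_log hr, mul_add, Real.exp_add, Real.rpow_def_of_pos hr]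
  have : Real.exp (Real.log r * -a) * Real.exp (a * Real.log r) = 1 := by
    rw [← Real.exp_add]; simp; ring
  calc _ = (Real.exp (Real.log r * -a) * Real.exp (a * Real.log r)) * (Real.exp (a * x) * Real.exp (-(b * (Real.exp x * r)))) := by
        rw [this]; ring_nf
    _ = _ := by ring

lemma line_cont (c θ r y : ℝ)
    (h : ∀ x : ℝ, (c : ℂ) * Complex.exp (θ * ((x : ℂ) + y * Complex.I)) + 1 ≠ 0) :
    Continuous (fun x : ℝ => Hfun c θ r ((x : ℂ) + y * Complex.I)) := by
  rw [continuous_iff_continuousAt]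
  intro x
  have := (Hfun_diffAt c θ r _ (h x)).continuousAt
  exact ContinuousAt.comp (f := fun x : ℝ => (x : ℂ) + y * Complex.I) this (by fun_prop)

/-- the bound hypothesis -/
def MB (c θ φ K : ℝ) : Prop := ∀ w : ℂ, 0 ≤ w.im → w.im ≤ φ →
      ((c : ℂ) * Complex.exp (θ * w) + 1 ≠ 0) ∧
      ∀ a : ℝ, 0 ≤ a → a ≤ θ → ‖mfun c θ w‖ ≤ K * Real.exp (a * w.re)

lemma MB.ne {c θ φ K : ℝ} (h : MB c θ φ K) {x y : ℝ} (h0 : 0 ≤ y) (h1 : y ≤ φ) :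
    (c : ℂ) * Complex.exp (θ * ((x : ℂ) + y * Complex.I)) + 1 ≠ 0 :=
  (h _ (by simpa using h0) (by simpa using h1)).1

lemma MB.bd {c θ φ K : ℝ} (h : MB c θ φ K) {x y : ℝ} (h0 : 0 ≤ y) (h1 : y ≤ φ)
    {a : ℝ} (ha : 0 ≤ a) (ha' : a ≤ θ) :
    ‖mfun c θ ((x : ℂ) + y * Complex.I)‖ ≤ K * Real.exp (a * x) := by
  simpa using (h ((x : ℂ) + y * Complex.I) (by simpa using h0) (by simpa using h1)).2 a ha ha'

lemma MB.Hbd {c θ φ K : ℝ} (h : MB c θ φ K) (r : ℝ) {x y : ℝ} (h0 : 0 ≤ y) (h1 : y ≤ φ)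
    {a : ℝ} (ha : 0 ≤ a) (ha' : a ≤ θ) :
    ‖Hfun c θ r ((x : ℂ) + y * Complex.I)‖ ≤
      K * Real.exp (a * x) * Real.exp (r * (Real.exp x * Real.cos y)) := by
  rw [Hfun, norm_mul, norm_exp_exp]
  exact mul_le_mul_of_nonneg_right (h.bd h0 h1 ha ha') (Real.exp_pos _).le

lemma MB.Hbd' {c θ φ K : ℝ} (h : MB c θ φ K) (hK : 0 < K) (hφ : φ < Real.pi)
    {r : ℝ} (hr : 0 < r) {x y : ℝ} (h0 : Real.pi / 2 ≤ y) (h1 : y ≤ φ)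
    {a : ℝ} (ha : 0 ≤ a) (ha' : a ≤ θ) :
    ‖Hfun c θ r ((x : ℂ) + y * Complex.I)‖ ≤ K * Real.exp (a * x) := by
  have hpi := Real.pi_pos
  refine (h.Hbd r (by linarith) h1 ha ha').trans ?_
  have hcos : Real.cos y ≤ 0 := Real.cos_nonpos_of_pi_div_two_le_of_le h0 (by linarith)
  have : Real.exp (r * (Real.exp x * Real.cos y)) ≤ 1 := by
    rw [Real.exp_le_one_iff]
    exact mul_nonpos_of_nonneg_of_nonpos hr.le
      (mul_nonpos_of_nonneg_of_nonpos (Real.exp_pos _).le hcos)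
  exact mul_le_of_le_one_right (by positivity) this

lemma MB.intIic {c θ φ K : ℝ} (h : MB c θ φ K) (hK : 0 < K) (hθ : 1 < θ) (hφ : φ < Real.pi)
    {r : ℝ} (hr : 0 < r) {y : ℝ} (h0 : Real.pi / 2 ≤ y) (h1 : y ≤ φ) (L : ℝ) :
    IntegrableOn (fun x : ℝ => Hfun c θ r ((x : ℂ) + y * Complex.I)) (Set.Iic L) := by
  have hpi := Real.pi_pos
  refine Integrable.mono' ((integrableOn_exp_Iic L).const_mul K)
    (line_cont c θ r y (fun x => h.ne (by linarith) h1)).aestronglyMeasurable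
    (ae_of_all _ fun x => ?_)
  simpa using h.Hbd' hK hφ hr h0 h1 (x := x) zero_le_one hθ.le

lemma MB.int {c θ φ K : ℝ} (h : MB c θ φ K) (hθ : 1 < θ) (hφ1 : Real.pi / 2 < φ)
    (hφ : φ < Real.pi) {r : ℝ} (hr : 0 < r) :
    Integrable (fun x : ℝ => Hfun c θ r ((x : ℂ) + φ * Complex.I)) := by
  have hpi := Real.pi_pos
  have hcos : Real.cos φ < 0 := Real.cos_neg_of_pi_div_two_lt_of_lt hφ1 (by linarith)
  refine Integrable.mono' ((integrable_exp_exp 1 (r * -Real.cos φ) one_pos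
    (mul_pos hr (by linarith))).const_mul K)
    (line_cont c θ r φ (fun x => h.ne (by linarith) le_rfl)).aestronglyMeasurable
    (ae_of_all _ fun x => ?_)
  refine (h.Hbd r (x := x) (by linarith) le_rfl zero_le_one hθ.le).trans (le_of_eq ?_)
  rw [mul_assoc]
  congr 3
  ring

lemma contour {c θ φ K : ℝ} (h : MB c θ φ K) (hK : 0 < K) (hθ : 1 < θ) (hφ1 : Real.pi / 2 < φ)
    (hφ : φ < Real.pi) {r : ℝ} (hr : 0 < r) :
    Tendsto (fun L : ℝ => ∫ x in Set.Iic L, Hfun c θ r ((x : ℂ) + (Real.pi / 2 : ℝ) * Complex.I))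
      atTop (𝓝 (∫ x : ℝ, Hfun c θ r ((x : ℂ) + φ * Complex.I))) := by
  have hpi := Real.pi_pos
  -- vertical continuity
  have hvc : ∀ x : ℝ, ContinuousOn (fun y : ℝ => Hfun c θ r ((x : ℂ) + y * Complex.I))
      (Set.Icc (Real.pi / 2) φ) := by
    intro x y hy
    have := (Hfun_diffAt c θ r _ (h.ne (x := x) (by linarith [hy.1]) hy.2)).continuousAt
    exact (ContinuousAt.comp (f := fun y : ℝ => (x : ℂ) + y * Complex.I) this
      (by fun_prop)).continuousWithinAt
  have hvm : ∀ x : ℝ, AEStronglyMeasurable (fun y : ℝ => Hfun c θ r ((x : ℂ) + y * Complex.I))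
      (volume.restrict (Set.uIoc (Real.pi / 2) φ)) := by
    intro x
    rw [Set.uIoc_of_le hφ1.le]
    exact ((hvc x).mono Set.Ioc_subset_Icc_self).aestronglyMeasurable measurableSet_Ioc
  have rect : ∀ M L : ℝ,
      (∫ x in M..L, Hfun c θ r ((x : ℂ) + (Real.pi / 2 : ℝ) * Complex.I))
        - (∫ x in M..L, Hfun c θ r ((x : ℂ) + φ * Complex.I))
        + Complex.I • (∫ y in (Real.pi / 2)..φ, Hfun c θ r ((L : ℂ) + y * Complex.I))
        - Complex.I • (∫ y in (Real.pi / 2)..φ, Hfun c θ r ((M : ℂ) + y * Complex.I)) = 0 := by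
    intro M L
    have := Complex.integral_boundary_rect_eq_zero_of_differentiableOn (Hfun c θ r)
      ⟨M, Real.pi / 2⟩ ⟨L, φ⟩ ?_
    · exact this
    · intro w hw
      rw [Complex.mem_reProdIm] at hw
      have h2 := hw.2
      simp only [Set.uIcc_of_le hφ1.le] at h2
      exact (Hfun_diffAt c θ r w (h w (by linarith [h2.1]) h2.2).1).differentiableWithinAt
  have vbot : Tendsto (fun M : ℝ => ∫ y in (Real.pi / 2)..φ, Hfun c θ r ((M : ℂ) + y * Complex.I))
      atBot (𝓝 0) := by
    have hz : (0:ℂ) = ∫ y in (Real.pi / 2)..φ, (0:ℂ) := by simp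
    rw [hz]
    refine intervalIntegral.tendsto_integral_filter_of_dominated_convergence (fun _ => K)
      (Eventually.of_forall hvm) (Eventually.of_forall fun M => ae_of_all _ fun y hy => ?_)
      (by simp) (ae_of_all _ fun y hy => ?_)
    · rw [Set.uIoc_of_le hφ1.le] at hy
      simpa using h.Hbd' hK hφ hr hy.1.le hy.2 (x := M) le_rfl (by linarith)
    · rw [Set.uIoc_of_le hφ1.le] at hy
      rw [tendsto_zero_iff_norm_tendsto_zero]
      refine squeeze_zero (fun _ => norm_nonneg _)
        (fun M => h.Hbd' hK hφ hr hy.1.le hy.2 (x := M) zero_le_one hθ.le) ?_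
      simpa using (Real.tendsto_exp_atBot.const_mul K)
  have vtop : Tendsto (fun M : ℝ => ∫ y in (Real.pi / 2)..φ, Hfun c θ r ((M : ℂ) + y * Complex.I))
      atTop (𝓝 0) := by
    have hz : (0:ℂ) = ∫ y in (Real.pi / 2)..φ, (0:ℂ) := by simp
    rw [hz]
    refine intervalIntegral.tendsto_integral_filter_of_dominated_convergence (fun _ => K)
      (Eventually.of_forall hvm) (Eventually.of_forall fun M => ae_of_all _ fun y hy => ?_)
      (by simp) (ae_of_all _ fun y hy => ?_)
    · rw [Set.uIoc_of_le hφ1.le] at hy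
      simpa using h.Hbd' hK hφ hr hy.1.le hy.2 (x := M) le_rfl (by linarith)
    · rw [Set.uIoc_of_le hφ1.le] at hy
      rw [tendsto_zero_iff_norm_tendsto_zero]
      refine squeeze_zero (fun _ => norm_nonneg _)
        (fun M => h.Hbd r (by linarith [hy.1]) hy.2 (x := M) le_rfl (by linarith)) ?_
      have hcos : Real.cos y < 0 := Real.cos_neg_of_pi_div_two_lt_of_lt hy.1 (by linarith [hy.2])
      have : Tendsto (fun M : ℝ => r * (Real.exp M * Real.cos y)) atTop atBot :=
        (Real.tendsto_exp_atTop.atTop_mul_const_of_neg hcos).const_mul_atBot hr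
      have h3 := (Real.tendsto_exp_atBot.comp this).const_mul K
      simpa using h3
  have half : ∀ L : ℝ,
      (∫ x in Set.Iic L, Hfun c θ r ((x : ℂ) + (Real.pi / 2 : ℝ) * Complex.I))
        = (∫ x in Set.Iic L, Hfun c θ r ((x : ℂ) + φ * Complex.I))
        - Complex.I • (∫ y in (Real.pi / 2)..φ, Hfun c θ r ((L : ℂ) + y * Complex.I)) := by
    intro L
    have t1 := intervalIntegral_tendsto_integral_Iic L
      (h.intIic hK hθ hφ hr le_rfl hφ1.le L) tendsto_id
    have t2 := intervalIntegral_tendsto_integral_Iic L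
      (h.intIic hK hθ hφ hr hφ1.le le_rfl L) tendsto_id
    have t3 := ((t1.sub t2).add_const (Complex.I • (∫ y in (Real.pi / 2)..φ,
      Hfun c θ r ((L : ℂ) + y * Complex.I)))).sub (vbot.const_smul Complex.I)
    simp only [id, rect] at t3
    have := tendsto_nhds_unique t3 tendsto_const_nhds
    rw [smul_zero, sub_zero] at this
    linear_combination this
  simp_rw [half]
  have t := ((aecover_Iic tendsto_id).integral_tendsto_of_countably_generated
    (h.int hθ hφ1 hφ hr)).sub (vtop.const_smul Complex.I)
  simpa using t

lemma MB.gint {c θ φ K : ℝ} (h : MB c θ φ K) (hK : 0 < K) (hθ : 1 < θ) (hφ1 : Real.pi / 2 < φ)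
    (hφ : φ < Real.pi) {r : ℝ} (hr : 0 < r) (g : ℝ → ℂ)
    (hg0 : ∀ s, g (-s) = (starRingEnd ℂ) (g s))
    (hg : ∀ x : ℝ, (Real.exp x : ℂ) * g (Real.exp x) =
      -Complex.I * Hfun c θ r ((x : ℂ) + (Real.pi / 2 : ℝ) * Complex.I)) (L : ℝ) :
    ∫ s in (-Real.exp L)..(Real.exp L), g s =
     ((2 * (∫ x in Set.Iic L,
       Hfun c θ r ((x : ℂ) + (Real.pi / 2 : ℝ) * Complex.I)).im : ℝ) : ℂ) := by
  have him : Real.exp '' Set.Iic L = Set.Ioc 0 (Real.exp L) := by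
    ext s
    simp only [Set.mem_image, Set.mem_Iic, Set.mem_Ioc]
    constructor
    · rintro ⟨x, hx, rfl⟩
      exact ⟨Real.exp_pos _, Real.exp_le_exp.2 hx⟩
    · rintro ⟨h0, h1⟩
      exact ⟨Real.log s, (Real.log_le_iff_le_exp h0).2 h1, Real.exp_log h0⟩
  have e : (fun x : ℝ => |Real.exp x| • g (Real.exp x)) =
      fun x : ℝ => -Complex.I * Hfun c θ r ((x : ℂ) + (Real.pi / 2 : ℝ) * Complex.I) := by
    ext x
    rw [abs_of_pos (Real.exp_pos x), ← hg, Complex.real_smul]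
  have hint : IntegrableOn g (Set.Ioc 0 (Real.exp L)) := by
    rw [← him, integrableOn_image_iff_integrableOn_abs_deriv_smul (f' := Real.exp) measurableSet_Iic
      (fun x _ => (Real.hasDerivAt_exp x).hasDerivWithinAt) Real.exp_injective.injOn, e]
    exact (h.intIic hK hθ hφ hr le_rfl hφ1.le L).const_mul _
  have hii : IntervalIntegrable g volume 0 (Real.exp L) :=
    (intervalIntegrable_iff_integrableOn_Ioc_of_le (Real.exp_pos L).le).2 hint
  have hval : ∫ s in (0:ℝ)..(Real.exp L), g s = -Complex.I * ∫ x in Set.Iic L,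
       Hfun c θ r ((x : ℂ) + (Real.pi / 2 : ℝ) * Complex.I) := by
    rw [intervalIntegral.integral_of_le (Real.exp_pos L).le, ← him,
      integral_image_eq_integral_abs_deriv_smul (f' := Real.exp) measurableSet_Iic
      (fun x _ => (Real.hasDerivAt_exp x).hasDerivWithinAt) Real.exp_injective.injOn, e,
      integral_const_mul]
  have hneg : ∫ s in (-Real.exp L)..0, g s =
      (starRingEnd ℂ) (∫ s in (0:ℝ)..(Real.exp L), g s) := by
    have h1 := intervalIntegral.integral_comp_neg (a := 0) (b := Real.exp L) g
    rw [neg_zero] at h1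
    rw [← h1]
    simp_rw [hg0]
    rw [intervalIntegral.integral_of_le (Real.exp_pos L).le,
      intervalIntegral.integral_of_le (Real.exp_pos L).le, integral_conj]
  have hiin : IntervalIntegrable g volume (-Real.exp L) 0 := by
    have h1 : IntervalIntegrable (fun s => g (-s)) volume 0 (Real.exp L) := by
      simp_rw [hg0]
      rw [intervalIntegrable_iff] at hii ⊢
      exact (integrable_norm_iff ((Complex.continuous_conj.comp_aestronglyMeasurable hii.1))).1
        (by simpa using hii.norm)
    have h2 := (IntervalIntegrable.iff_comp_neg (f := g) (a := -Real.exp L) (b := 0)).2 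
    apply h2
    simpa using h1.symm
  rw [← intervalIntegral.integral_add_adjacent_intervals hiin hii, hneg, hval]
  set J := ∫ x in Set.Iic L, Hfun c θ r ((x : ℂ) + (Real.pi / 2 : ℝ) * Complex.I)
  apply Complex.ext <;> simp <;> ring

lemma FVapprox_eq {c θ φ K : ℝ} (h : MB c θ φ K) (hK : 0 < K) (hθ : 1 < θ)
    (hφ1 : Real.pi / 2 < φ) (hφ : φ < Real.pi) {r : ℝ} (hr : 0 < r) (L : ℝ) :
    FVapprox c θ (Real.exp L) (Real.exp L) r =
     ((1 / Real.pi * (∫ x in Set.Iic L,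
       Hfun c θ r ((x : ℂ) + (Real.pi / 2 : ℝ) * Complex.I)).im : ℝ) : ℂ) := by
  unfold FVapprox
  rw [h.gint hK hθ hφ1 hφ hr _ _ _ L]
  · have : (Real.pi : ℂ) ≠ 0 := by exact_mod_cast Real.pi_pos.ne'
    push_cast
    field_simp
  · intro s
    have e1 : Real.sign (-s) = - Real.sign s := by
      rcases lt_trichotomy s 0 with h | h | h
      · rw [Real.sign_of_neg h, Real.sign_of_pos (by linarith)]; norm_num
      · simp [h]
      · rw [Real.sign_of_pos h, Real.sign_of_neg (by linarith)]
    simp only [map_div₀, map_mul, map_add, map_one, ← Complex.exp_conj, Complex.conj_ofReal,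
      Complex.conj_I, abs_neg, e1, map_sub, map_ofNat]
    push_cast
    ring_nf
  · intro x
    have hx := Real.exp_pos x
    rw [Real.sign_of_pos hx, abs_of_pos hx, Hfun, mfun]
    have e1 : Complex.exp ((x : ℂ) + (Real.pi / 2 : ℝ) * Complex.I) = Complex.exp x * Complex.I := by
      rw [Complex.exp_add]; push_cast; rw [Complex.exp_pi_div_two_mul_I]
    have e2 : Complex.exp (θ * ((x : ℂ) + (Real.pi / 2 : ℝ) * Complex.I)) =
        Complex.exp (Complex.I * (1 : ℝ) * θ * Real.pi / 2) * ((Real.exp x ^ θ : ℝ) : ℂ) := by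
      rw [← Real.exp_mul, Complex.ofReal_exp, ← Complex.exp_add]
      congr 1; push_cast; ring
    have e3 : (Real.exp x : ℂ) * ((Real.exp x ^ (θ - 1) : ℝ) : ℂ) = ((Real.exp x ^ θ : ℝ) : ℂ) := by
      rw [← Real.exp_mul, ← Real.exp_mul, ← Complex.ofReal_mul, ← Real.exp_add]
      congr 2; ring
    have e4 : Complex.exp (Complex.I * (1 : ℝ) * (θ - 1) * Real.pi / 2) =
        -Complex.I * Complex.exp (Complex.I * (1 : ℝ) * θ * Real.pi / 2) := by
      have : -Complex.I = Complex.exp (-(Real.pi / 2 * Complex.I)) := by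
        rw [Complex.exp_neg, Complex.exp_pi_div_two_mul_I, Complex.inv_I]
      rw [this, ← Complex.exp_add]
      congr 1; push_cast; ring
    rw [e2, e1, e4, ← e3]
    have e5 : Complex.I * r * (Real.exp x : ℂ) = r * (Complex.exp x * Complex.I) := by
      push_cast; ring
    rw [e5]
    ring

lemma Hderiv_int {c θ φ K : ℝ} (h : MB c θ φ K) (hφ1 : Real.pi / 2 < φ)
    (hφ : φ < Real.pi) {r r' : ℝ} (hr' : r' ≤ r) (x : ℝ) {a : ℝ} (ha : 0 ≤ a) (ha' : a ≤ θ) :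
    ‖Complex.exp ((x : ℂ) + φ * Complex.I) * Hfun c θ r ((x : ℂ) + φ * Complex.I)‖ ≤
      K * (Real.exp ((a + 1) * x) * Real.exp (-(r' * -Real.cos φ * Real.exp x))) := by
  have hpi := Real.pi_pos
  have hcos : Real.cos φ < 0 := Real.cos_neg_of_pi_div_two_lt_of_lt hφ1 (by linarith)
  rw [norm_mul, Complex.norm_exp]
  have h1 := h.Hbd r (x := x) (by linarith) le_rfl ha ha'
  have e : ((x : ℂ) + φ * Complex.I).re = x := by simp
  rw [e]
  have h2 : Real.exp (r * (Real.exp x * Real.cos φ)) ≤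
      Real.exp (-(r' * -Real.cos φ * Real.exp x)) := by
    apply Real.exp_le_exp.2
    have : Real.exp x * Real.cos φ ≤ 0 :=
      mul_nonpos_of_nonneg_of_nonpos (Real.exp_pos _).le hcos.le
    nlinarith
  have hK : 0 ≤ K * Real.exp (a * x) := le_trans (norm_nonneg _) (h.bd (by linarith) le_rfl ha ha')
  calc _ ≤ Real.exp x * (K * Real.exp (a * x) * Real.exp (-(r' * -Real.cos φ * Real.exp x))) := by
        apply mul_le_mul_of_nonneg_left _ (Real.exp_pos _).le
        exact h1.trans (mul_le_mul_of_nonneg_left h2 hK)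
    _ = _ := by rw [add_mul, Real.exp_add, one_mul]; ring

noncomputable def Fr (c θ φ r : ℝ) : ℝ :=
  1 / Real.pi * (∫ x : ℝ, Hfun c θ r ((x : ℂ) + φ * Complex.I)).im

noncomputable def Fr' (c θ φ r : ℝ) : ℝ :=
  1 / Real.pi * (∫ x : ℝ, Complex.exp ((x : ℂ) + φ * Complex.I) *
    Hfun c θ r ((x : ℂ) + φ * Complex.I)).im

lemma Fr_hasDeriv {c θ φ K : ℝ} (h : MB c θ φ K) (hθ : 1 < θ) (hφ1 : Real.pi / 2 < φ)
    (hφ : φ < Real.pi) {r : ℝ} (hr : 0 < r) :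
    HasDerivAt (Fr c θ φ) (Fr' c θ φ r) r := by
  have hpi := Real.pi_pos
  have hcos : Real.cos φ < 0 := Real.cos_neg_of_pi_div_two_lt_of_lt hφ1 (by linarith)
  have hlc : ∀ r, Continuous (fun x : ℝ => Hfun c θ r ((x : ℂ) + φ * Complex.I)) := fun r =>
    line_cont c θ r φ (fun x => h.ne (by linarith) le_rfl)
  have key := hasDerivAt_integral_of_dominated_loc_of_deriv_le (μ := volume) (x₀ := r)
    (s := Set.Ioi (r / 2))
    (F := fun r x => Hfun c θ r ((x : ℂ) + φ * Complex.I))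
    (F' := fun r x => Complex.exp ((x : ℂ) + φ * Complex.I) *
      Hfun c θ r ((x : ℂ) + φ * Complex.I))
    (bound := fun x => K * (Real.exp ((1 + 1) * x) *
      Real.exp (-(r / 2 * -Real.cos φ * Real.exp x))))
    (Ioi_mem_nhds (by linarith))
    (Eventually.of_forall fun r => (hlc r).aestronglyMeasurable)
    (h.int hθ hφ1 hφ hr)
    ((Continuous.mul (by fun_prop) (hlc r)).aestronglyMeasurable)
    (ae_of_all _ fun x r' hr' => Hderiv_int h hφ1 hφ (le_of_lt hr') x zero_le_one hθ.le)
    ((integrable_exp_exp (1 + 1) (r / 2 * -Real.cos φ) (by norm_num)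
      (mul_pos (by linarith) (by linarith))).const_mul K)
    (ae_of_all _ fun x r' _ => ?_)
  · have := (Complex.imCLM.hasFDerivAt.comp_hasDerivAt r key.2).const_mul (1 / Real.pi)
    exact this
  · unfold Hfun
    have h1 : HasDerivAt (fun r' : ℝ => (r' : ℂ) * Complex.exp ((x : ℂ) + φ * Complex.I))
        (1 * Complex.exp ((x : ℂ) + φ * Complex.I)) r' :=
      (Complex.ofRealCLM.hasDerivAt (x := r')).mul_const _
    have h2 := h1.cexp.const_mul (mfun c θ ((x : ℂ) + φ * Complex.I))
    refine h2.congr_deriv ?_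
    simp only [one_mul]
    ring

lemma Fr_bound {c θ φ K : ℝ} (h : MB c θ φ K) (hφ1 : Real.pi / 2 < φ)
    (hφ : φ < Real.pi) (a : ℝ) (ha : 0 < a) (ha' : a ≤ θ) :
    ∃ C, ∀ r : ℝ, 0 < r → |Fr c θ φ r| ≤ C * r ^ (-a) ∧ |Fr' c θ φ r| ≤ C * r ^ (-a - 1) := by
  have hpi := Real.pi_pos
  have hcos : Real.cos φ < 0 := Real.cos_neg_of_pi_div_two_lt_of_lt hφ1 (by linarith)
  set A1 := ∫ x : ℝ, Real.exp (a * x) * Real.exp (-(-Real.cos φ * Real.exp x))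
  set A2 := ∫ x : ℝ, Real.exp ((a + 1) * x) * Real.exp (-(-Real.cos φ * Real.exp x))
  refine ⟨max (1 / Real.pi * (K * A1)) (1 / Real.pi * (K * A2)), fun r hr => ⟨?_, ?_⟩⟩
  · refine le_trans ?_ (mul_le_mul_of_nonneg_right (le_max_left _ _) (by positivity))
    rw [Fr, abs_mul, abs_of_pos (by positivity), mul_assoc]
    refine mul_le_mul_of_nonneg_left ((Complex.abs_im_le_norm _).trans ?_) (by positivity)
    refine (norm_integral_le_of_norm_le ((integrable_exp_exp a (r * -Real.cos φ) ha
      (mul_pos hr (by linarith))).const_mul K) (ae_of_all _ fun x => ?_)).trans (le_of_eq ?_)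
    · refine (h.Hbd r (x := x) (by linarith) le_rfl ha.le ha').trans (le_of_eq ?_)
      rw [mul_assoc]
      congr 3
      ring
    · rw [integral_const_mul, integral_exp_exp a _ r hr]; ring
  · refine le_trans ?_ (mul_le_mul_of_nonneg_right (le_max_right _ _) (by positivity))
    rw [Fr', abs_mul, abs_of_pos (by positivity), mul_assoc]
    refine mul_le_mul_of_nonneg_left ((Complex.abs_im_le_norm _).trans ?_) (by positivity)
    refine (norm_integral_le_of_norm_le ((integrable_exp_exp (a + 1) (r * -Real.cos φ)
      (by linarith)
      (mul_pos hr (by linarith))).const_mul K) (ae_of_all _ fun x => ?_)).trans (le_of_eq ?_)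
    · exact Hderiv_int h hφ1 hφ le_rfl x ha.le ha'
    · rw [integral_const_mul, integral_exp_exp (a + 1) _ r hr, neg_add']; ring

lemma FV_eq {c θ φ K : ℝ} (h : MB c θ φ K) (hK : 0 < K) (hθ : 1 < θ)
    (hφ1 : Real.pi / 2 < φ) (hφ : φ < Real.pi) (FV : ℝ → ℝ)
    (hFV : ∀ r : ℝ, r ≠ 0 →
      Tendsto (fun p : ℝ × ℝ => FVapprox c θ p.1 p.2 r) (atTop ×ˢ atTop)
        (𝓝 ((FV r : ℝ) : ℂ))) {r : ℝ} (hr : 0 < r) : FV r = Fr c θ φ r := by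
  have t1 := (hFV r hr.ne').comp (Real.tendsto_exp_atTop.prodMk Real.tendsto_exp_atTop)
  have t2 : Tendsto (fun L => FVapprox c θ (Real.exp L) (Real.exp L) r) atTop
      (𝓝 ((Fr c θ φ r : ℝ) : ℂ)) := by
    simp_rw [FVapprox_eq h hK hθ hφ1 hφ hr]
    apply (Complex.continuous_ofReal.tendsto _).comp
    exact ((Complex.continuous_im.tendsto _).comp (contour h hK hθ hφ1 hφ hr)).const_mul _
  exact_mod_cast tendsto_nhds_unique t1 t2

lemma intg (p b1 b2 C : ℝ) (h1 : b1 < p) (h2 : p < b2) (f : ℝ → ℝ)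
    (hf : AEStronglyMeasurable f (volume.restrict (Set.Ioi 0)))
    (hb1 : ∀ y > 0, |f y| ≤ C * y ^ (p - b1 - 1))
    (hb2 : ∀ y > 0, |f y| ≤ C * y ^ (p - b2 - 1)) : IntegrableOn f (Set.Ioi 0) := by
  have hU : Set.Ioi (0:ℝ) = Set.Ioc 0 1 ∪ Set.Ioi 1 := by
    rw [Set.Ioc_union_Ioi_eq_Ioi zero_le_one]
  rw [hU]
  refine IntegrableOn.union ?_ ?_
  · have i1 : IntegrableOn (fun y : ℝ => y ^ (p - b1 - 1)) (Set.Ioc 0 1) := by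
      rw [integrableOn_Ioc_iff_integrableOn_Ioo,
        intervalIntegral.integrableOn_Ioo_rpow_iff one_pos]
      linarith
    refine Integrable.mono' (i1.const_mul C)
      (hf.mono_measure (Measure.restrict_mono Set.Ioc_subset_Ioi_self le_rfl)) ?_
    filter_upwards [ae_restrict_mem measurableSet_Ioc] with y hy
    exact hb1 y hy.1
  · have i1 : IntegrableOn (fun y : ℝ => y ^ (p - b2 - 1)) (Set.Ioi 1) :=
      integrableOn_Ioi_rpow_of_lt (by linarith) one_pos
    refine Integrable.mono' (i1.const_mul C)
      (hf.mono_measure (Measure.restrict_mono (Set.Ioi_subset_Ioi zero_le_one) le_rfl)) ?_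
    filter_upwards [ae_restrict_mem measurableSet_Ioi] with y hy
    exact hb2 y (lt_trans one_pos hy)

lemma W_bound (ζ Qs : ℝ) (hζ1 : 0 < ζ) (w : ℕ → ℝ) (hw : ∀ k, 0 ≤ w k) (hwsum : Summable w)
    (W : ℝ → ℝ) (hW0 : ∀ l, 0 ≤ W l) (hW1 : ∀ l, W l ≤ ∑' k, w k)
    (hs : Tendsto (fun l : ℝ => W l / l ^ ζ) (𝓝[>] 0) (𝓝 Qs)) :
    ∃ D, 0 ≤ D ∧ ∀ l > 0, W l ≤ D * l ^ ζ := by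
  have he := hs.eventually (Iio_mem_nhds (lt_add_one Qs))
  obtain ⟨l0, hl0, hl⟩ := mem_nhdsGT_iff_exists_Ioo_subset.1 he
  have hl0' : 0 < l0 := hl0
  have hT : 0 ≤ ∑' k, w k := tsum_nonneg hw
  refine ⟨max (Qs + 1) ((∑' k, w k) / l0 ^ ζ), le_max_of_le_right (by positivity), fun l hl1 => ?_⟩
  have hlp : 0 < l ^ ζ := Real.rpow_pos_of_pos hl1 _
  rcases lt_or_ge l l0 with h | h
  · have : W l / l ^ ζ < Qs + 1 := hl ⟨hl1, h⟩
    rw [div_lt_iff₀ hlp] at this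
    exact this.le.trans (mul_le_mul_of_nonneg_right (le_max_left _ _) hlp.le)
  · refine (hW1 l).trans (le_trans ?_ (mul_le_mul_of_nonneg_right (le_max_right _ _) hlp.le))
    rw [div_mul_eq_mul_div, le_div_iff₀ (Real.rpow_pos_of_pos hl0' _)]
    exact mul_le_mul_of_nonneg_left (Real.rpow_le_rpow hl0'.le h hζ1.le) hT

lemma abel (θ ζ Qs : ℝ) (hθ : 0 < θ) (hζ : 0 < ζ) (G G' : ℝ → ℝ)
    (hd : ∀ y > 0, HasDerivAt G (G' y) y) (hm : Measurable G') (b1 b2 C : ℝ)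
    (hb0 : 0 < b1) (hb1 : b1 < θ * ζ) (hb2 : θ * ζ < b2)
    (hG1 : ∀ y > 0, |G y| ≤ C * y ^ (-b1)) (hG2 : ∀ y > 0, |G y| ≤ C * y ^ (-b2))
    (hG1' : ∀ y > 0, |G' y| ≤ C * y ^ (-b1 - 1)) (hG2' : ∀ y > 0, |G' y| ≤ C * y ^ (-b2 - 1))
    (lam : ℕ → ℝ) (hpos : ∀ k, 0 < lam k)
    (w : ℕ → ℝ) (hw : ∀ k, 0 ≤ w k) (hwsum : Summable w)
    (hsource : Tendsto (fun l : ℝ => (∑' k : {k : ℕ // lam k < l}, w (k : ℕ)) / l ^ ζ)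
      (𝓝[>] 0) (𝓝 Qs)) :
    IntegrableOn (fun r : ℝ => r ^ (θ * ζ - 1) * G r) (Set.Ioi 0) ∧
    Tendsto (fun t : ℕ => (t : ℝ) ^ (θ * ζ) *
        ∑' k : ℕ, w k * G ((t : ℝ) * (lam k) ^ (1 / θ))) atTop
      (𝓝 (Qs * (θ * ζ) * ∫ r in Set.Ioi (0 : ℝ), r ^ (θ * ζ - 1) * G r)) := by
  set p := θ * ζ with hp
  have hp0 : 0 < p := mul_pos hθ hζ
  set W : ℝ → ℝ := fun l => ∑' k, Set.indicator {k | lam k < l} w k with hWdef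
  have hWsub : ∀ l : ℝ, (∑' k : {k : ℕ // lam k < l}, w (k : ℕ)) = W l := fun l =>
    tsum_subtype {k | lam k < l} w
  simp_rw [hWsub] at hsource
  have hW0 : ∀ l, 0 ≤ W l := fun l => tsum_nonneg fun k => Set.indicator_nonneg (fun k _ => hw k) k
  have hW1 : ∀ l, W l ≤ ∑' k, w k := fun l =>
    (hwsum.indicator _).tsum_le_tsum (fun k => Set.indicator_le_self' (fun k _ => hw k) k) hwsum
  obtain ⟨D, hD0, hD⟩ := W_bound ζ Qs hζ w hw hwsum W hW0 hW1 hsource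
  have hWmono : Monotone W := by
    intro l l' hll
    refine (hwsum.indicator _).tsum_le_tsum (fun k => ?_) (hwsum.indicator _)
    exact Set.indicator_le_indicator_of_subset (fun k hk => lt_of_lt_of_le hk hll) hw k
  have hGc : ContinuousOn G (Set.Ioi 0) := fun y hy => (hd y hy).continuousAt.continuousWithinAt
  -- integrability
  have hpow : ∀ (q b y : ℝ), 0 < y → ∀ g : ℝ, |g| ≤ C * y ^ b → |y ^ q * g| ≤ C * y ^ (q + b) := by
    intro q b y hy g hg
    rw [abs_mul, abs_of_pos (Real.rpow_pos_of_pos hy _), Real.rpow_add hy]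
    calc _ ≤ y ^ q * (C * y ^ b) := mul_le_mul_of_nonneg_left hg (Real.rpow_pos_of_pos hy _).le
      _ = _ := by ring
  have hpc : ∀ q : ℝ, ContinuousOn (fun y : ℝ => y ^ q) (Set.Ioi 0) := fun q y hy =>
    (Real.continuousAt_rpow_const y q (Or.inl (ne_of_gt hy))).continuousWithinAt
  have I1 : IntegrableOn (fun r : ℝ => r ^ (p - 1) * G r) (Set.Ioi 0) := by
    refine intg p b1 b2 C hb1 hb2 _
      (((hpc _).mul hGc).aestronglyMeasurable measurableSet_Ioi) ?_ ?_
    · intro y hy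
      convert hpow (p - 1) (-b1) y hy _ (hG1 y hy) using 3; ring
    · intro y hy
      convert hpow (p - 1) (-b2) y hy _ (hG2 y hy) using 3; ring
  have I2 : IntegrableOn (fun r : ℝ => r ^ p * G' r) (Set.Ioi 0) := by
    refine intg p b1 b2 C hb1 hb2 _
      (((hpc _).aestronglyMeasurable measurableSet_Ioi).mul hm.aestronglyMeasurable) ?_ ?_
    · intro y hy
      convert hpow p (-b1 - 1) y hy _ (hG1' y hy) using 3; ring
    · intro y hy
      convert hpow p (-b2 - 1) y hy _ (hG2' y hy) using 3; ring
  refine ⟨I1, ?_⟩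
  have hpowtop : ∀ q : ℝ, q < 0 → Tendsto (fun y : ℝ => C * y ^ q) atTop (𝓝 0) := by
    intro q hq
    have := (tendsto_rpow_neg_atTop (neg_pos.2 hq)).const_mul C
    simpa using this
  have hGtop : Tendsto G atTop (𝓝 0) := by
    rw [tendsto_zero_iff_norm_tendsto_zero]
    refine squeeze_zero' (Eventually.of_forall fun _ => norm_nonneg _) ?_ (hpowtop (-b1) (by linarith))
    filter_upwards [eventually_gt_atTop 0] with y hy using hG1 y hy
  -- integration by parts
  have IBP : ∫ y in Set.Ioi (0:ℝ), y ^ p * G' y = - (p * ∫ y in Set.Ioi (0:ℝ), y ^ (p - 1) * G y) := by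
    have I1' : IntegrableOn (fun y : ℝ => p * y ^ (p - 1) * G y) (Set.Ioi 0) := by
      simp_rw [mul_assoc]
      exact I1.const_mul p
    have := integral_Ioi_mul_deriv_eq_deriv_mul (a := 0) (u := fun y : ℝ => y ^ p) (v := G)
      (u' := fun y : ℝ => p * y ^ (p - 1)) (v' := G') (a' := 0) (b' := 0)
      (fun y hy => Real.hasDerivAt_rpow_const (Or.inl (ne_of_gt hy))) (fun y hy => hd y hy) I2 I1' ?_ ?_
    · rw [this]
      simp_rw [mul_assoc]
      rw [integral_const_mul]; ring
    · rw [tendsto_zero_iff_norm_tendsto_zero]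
      have t : Tendsto (fun y : ℝ => C * y ^ (p + -b1)) (𝓝[>] 0) (𝓝 0) := by
        have : Tendsto (fun y : ℝ => y ^ (p + -b1)) (𝓝 0) (𝓝 0) := by
          have := (Real.continuousAt_rpow_const 0 (p + -b1) (Or.inr (by linarith))).tendsto
          rwa [Real.zero_rpow (by linarith)] at this
        simpa using (this.mono_left nhdsWithin_le_nhds).const_mul C
      refine squeeze_zero' (Eventually.of_forall fun _ => norm_nonneg _) ?_ t
      filter_upwards [self_mem_nhdsWithin] with y hy using hpow _ _ y hy _ (hG1 y hy)
    · rw [tendsto_zero_iff_norm_tendsto_zero]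
      refine squeeze_zero' (Eventually.of_forall fun _ => norm_nonneg _) ?_
        (hpowtop (p + -b2) (by linarith))
      filter_upwards [eventually_gt_atTop 0] with y hy using hpow _ _ y hy _ (hG2 y hy)
  -- tail formula
  have tailI : ∀ x : ℝ, 0 < x → IntegrableOn G' (Set.Ioi x) := by
    intro x hx
    refine Integrable.mono' ((integrableOn_Ioi_rpow_of_lt (a := -b1 - 1) (by linarith) hx).const_mul C)
      hm.aestronglyMeasurable ?_
    filter_upwards [ae_restrict_mem measurableSet_Ioi] with y hy
    exact hG1' y (lt_trans hx hy)
  have tail : ∀ x : ℝ, 0 < x → ∫ y in Set.Ioi x, -G' y = G x := by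
    intro x hx
    rw [integral_neg, integral_Ioi_of_hasDerivAt_of_tendsto'
      (fun y hy => hd y (lt_of_lt_of_le hx hy)) (tailI x hx) hGtop]
    ring
  have hiff : ∀ (t : ℝ), 0 < t → ∀ y, 0 < y → ∀ k,
      (t * (lam k) ^ (1 / θ) < y ↔ lam k < (y / t) ^ θ) := by
    intro t ht y hy k
    rw [← lt_div_iff₀' ht, one_div, Real.rpow_inv_lt_iff_of_pos (hpos k).le (by positivity) hθ]
  have hWt : ∀ t : ℝ, 0 < t → ∀ y, 0 < y → W ((y / t) ^ θ) ≤ D * (y / t) ^ p := by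
    intro t ht y hy
    have := hD ((y / t) ^ θ) (by positivity)
    rwa [← Real.rpow_mul (by positivity)] at this
  have layer : ∀ t : ℝ, 0 < t → ∑' k : ℕ, w k * G (t * (lam k) ^ (1 / θ)) =
      ∫ y in Set.Ioi (0:ℝ), -G' y * W ((y / t) ^ θ) := by
    intro t ht
    set f : ℕ → ℝ → ℝ := fun k y =>
      w k * (Set.Ioi (t * (lam k) ^ (1 / θ))).indicator (fun y => -G' y) y with hf
    have hfm : ∀ k, Measurable (f k) := fun k =>
      (hm.neg.indicator measurableSet_Ioi).const_mul _
    have hfe : ∀ y, 0 < y → ∀ k, f k y =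
        -G' y * Set.indicator {k | lam k < (y / t) ^ θ} w k := by
      intro y hy k
      simp only [hf, Set.indicator_apply, Set.mem_Ioi, Set.mem_setOf_eq, hiff t ht y hy k]
      split_ifs <;> ring
    have hfs : ∀ y, 0 < y → ∑' k, f k y = -G' y * W ((y / t) ^ θ) := by
      intro y hy
      simp_rw [hfe y hy]
      rw [tsum_mul_left]
    have hfi : ∀ k, ∫ y in Set.Ioi (0:ℝ), f k y = w k * G (t * (lam k) ^ (1 / θ)) := by
      intro k
      have hx : 0 < t * (lam k) ^ (1 / θ) := mul_pos ht (Real.rpow_pos_of_pos (hpos k) _)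
      rw [integral_const_mul, setIntegral_indicator measurableSet_Ioi,
        Set.inter_eq_self_of_subset_right (Set.Ioi_subset_Ioi hx.le), tail _ hx]
    have hfin : ∑' k, ∫⁻ y in Set.Ioi (0:ℝ), ‖f k y‖ₑ ≠ ⊤ := by
      rw [← lintegral_tsum fun k => (hfm k).enorm.aemeasurable]
      have I3 : IntegrableOn (fun y : ℝ => D * t ^ (-p) * |y ^ p * G' y|) (Set.Ioi 0) :=
        (I2.abs).const_mul _
      refine ne_of_lt (lt_of_le_of_lt ?_ I3.lintegral_lt_top)
      refine setLIntegral_mono' measurableSet_Ioi fun y hy => ?_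
      have hy : 0 < y := hy
      have e1 : ∀ k, ‖f k y‖ = |G' y| * Set.indicator {k | lam k < (y / t) ^ θ} w k := by
        intro k
        rw [hfe y hy, norm_mul, norm_neg, Real.norm_eq_abs,
          Real.norm_of_nonneg (Set.indicator_nonneg (fun k _ => hw k) k)]
      have e2 : ∑' k, ‖f k y‖ = |G' y| * W ((y / t) ^ θ) := by
        simp_rw [e1]; rw [tsum_mul_left]
      have e3 : Summable fun k => ‖f k y‖ := by
        simp_rw [e1]; exact (hwsum.indicator _).mul_left _
      have e4 : ∑' k, ‖f k y‖ₑ = ENNReal.ofReal (∑' k, ‖f k y‖) := by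
        rw [ENNReal.ofReal_tsum_of_nonneg (fun _ => norm_nonneg _) e3]
        simp_rw [ofReal_norm]
      rw [e4, e2]
      apply ENNReal.ofReal_le_ofReal
      calc |G' y| * W ((y / t) ^ θ) ≤ |G' y| * (D * (y / t) ^ p) :=
            mul_le_mul_of_nonneg_left (hWt t ht y hy) (abs_nonneg _)
        _ = _ := by
          rw [abs_mul, abs_of_pos (Real.rpow_pos_of_pos hy p), Real.div_rpow hy.le ht.le,
            Real.rpow_neg ht.le]
          ring
    have := integral_tsum (μ := volume.restrict (Set.Ioi (0:ℝ)))
      (fun k => (hfm k).aestronglyMeasurable) hfin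
    simp_rw [hfi] at this
    rw [← this]
    exact setIntegral_congr_fun measurableSet_Ioi fun y hy => hfs y hy
  -- limit
  have lim : Tendsto (fun t : ℕ => ∫ y in Set.Ioi (0:ℝ), -G' y * ((t:ℝ) ^ p * W ((y / t) ^ θ))) atTop
      (𝓝 (∫ y in Set.Ioi (0:ℝ), -G' y * (Qs * y ^ p))) := by
    refine tendsto_integral_filter_of_dominated_convergence (fun y => D * |y ^ p * G' y|)
      ?_ ?_ ((I2.abs).const_mul D) ?_
    · filter_upwards [eventually_gt_atTop 0] with t ht
      have ht' : (0:ℝ) < t := Nat.cast_pos.2 ht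
      refine (hm.neg.mul (Measurable.const_mul ?_ _)).aestronglyMeasurable
      exact hWmono.measurable.comp (by fun_prop)
    · filter_upwards [eventually_gt_atTop 0] with t ht
      have ht' : (0:ℝ) < t := Nat.cast_pos.2 ht
      filter_upwards [ae_restrict_mem measurableSet_Ioi] with y hy
      have hy : 0 < y := hy
      rw [norm_mul, norm_neg, Real.norm_eq_abs,
        Real.norm_of_nonneg (mul_nonneg (by positivity) (hW0 _)),
        abs_mul, abs_of_pos (Real.rpow_pos_of_pos hy p)]
      calc _ ≤ |G' y| * ((t:ℝ) ^ p * (D * (y / t) ^ p)) := by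
            gcongr
            exact hWt t ht' y hy
        _ = _ := by
            rw [Real.div_rpow hy.le ht'.le]
            have : (t:ℝ) ^ p ≠ 0 := (Real.rpow_pos_of_pos ht' p).ne'
            field_simp
    · filter_upwards [ae_restrict_mem measurableSet_Ioi] with y hy
      have hy : 0 < y := hy
      refine Tendsto.const_mul _ ?_
      have t1 : Tendsto (fun t : ℕ => (y / (t:ℝ)) ^ θ) atTop (𝓝[>] 0) := by
        rw [tendsto_nhdsWithin_iff]
        constructor
        · have := (tendsto_const_div_atTop_nhds_zero_nat y).rpow_const (p := θ) (Or.inr hθ.le)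
          rwa [Real.zero_rpow hθ.ne'] at this
        · filter_upwards [eventually_gt_atTop 0] with t ht
          have ht' : (0:ℝ) < t := Nat.cast_pos.2 ht
          exact Real.rpow_pos_of_pos (by positivity) _
      have t2 := (hsource.comp t1).mul_const (y ^ p)
      refine t2.congr' ?_
      filter_upwards [eventually_gt_atTop 0] with t ht
      have ht' : (0:ℝ) < t := Nat.cast_pos.2 ht
      simp only [Function.comp]
      rw [← Real.rpow_mul (by positivity), ← hp, Real.div_rpow hy.le ht'.le p]
      have h1 : (t:ℝ) ^ p ≠ 0 := (Real.rpow_pos_of_pos ht' p).ne'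
      have h2 : y ^ p ≠ 0 := (Real.rpow_pos_of_pos hy p).ne'
      field_simp
  have hend : ∫ y in Set.Ioi (0:ℝ), -G' y * (Qs * y ^ p) =
      Qs * p * ∫ r in Set.Ioi (0 : ℝ), r ^ (p - 1) * G r := by
    have : ∀ y : ℝ, -G' y * (Qs * y ^ p) = -Qs * (y ^ p * G' y) := fun y => by ring
    simp_rw [this]
    rw [integral_const_mul, IBP]; ring
  rw [← hend]
  refine lim.congr' ?_
  filter_upwards [eventually_gt_atTop 0] with t ht
  have ht' : (0:ℝ) < t := Nat.cast_pos.2 ht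
  rw [layer t ht', ← integral_const_mul]
  congr 1
  ext y
  ring

/-- `∫_0^∞ r^{θζ−1}·F_V(r)² dr < ∞` and
`t^{θζ}·Σ_k w_k·F_V(t·λ_k^{1/θ})² → Q·θζ·∫_0^∞ r^{θζ−1}·F_V(r)² dr` as the integer
`t → ∞`. Here `lam k`, `w k` denote `λ_{k+1}`, `w_{k+1}` (index shift from `k ≥ 1` to `k ≥ 0`). -/
theorem stmt18 (c θ : ℝ) (hc : 0 < c) (hθ1 : 1 < θ) (hθ2 : θ < 2)
    (FV : ℝ → ℝ)
    (hFV : ∀ r : ℝ, r ≠ 0 →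
      Tendsto (fun p : ℝ × ℝ => FVapprox c θ p.1 p.2 r) (atTop ×ˢ atTop)
        (𝓝 ((FV r : ℝ) : ℂ)))
    (ζ Qs : ℝ) (hζ1 : 0 < ζ) (hζ2 : ζ < 2) (hQs : 0 < Qs)
    (lam : ℕ → ℝ) (hpos : ∀ k, 0 < lam k) (hbdd : BddAbove (Set.range lam))
    (w : ℕ → ℝ) (hw : ∀ k, 0 ≤ w k) (hwsum : Summable w)
    (hsource : Tendsto (fun l : ℝ => (∑' k : {k : ℕ // lam k < l}, w (k : ℕ)) / l ^ ζ)
      (𝓝[>] 0) (𝓝 Qs)) :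
    IntegrableOn (fun r : ℝ => r ^ (θ * ζ - 1) * (FV r) ^ 2) (Set.Ioi 0) ∧
    Tendsto (fun t : ℕ => (t : ℝ) ^ (θ * ζ) *
        ∑' k : ℕ, w k * (FV ((t : ℝ) * (lam k) ^ (1 / θ))) ^ 2) atTop
      (𝓝 (Qs * (θ * ζ) * ∫ r in Set.Ioi (0 : ℝ), r ^ (θ * ζ - 1) * (FV r) ^ 2)) := by
  have hpi := Real.pi_pos
  have hlt : Real.pi / 2 < Real.pi / θ := by
    apply div_lt_div_of_pos_left hpi (by linarith) hθ2
  obtain ⟨φ, hφ1, hφ2⟩ := exists_between hlt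
  have hφ3 : θ * φ < Real.pi := by
    rwa [lt_div_iff₀' (by linarith)] at hφ2
  have hφ4 : φ < Real.pi := by nlinarith
  obtain ⟨K, hK, hMB⟩ := mfun_bound c θ φ hc hθ1 hφ1 hφ3
  replace hMB : MB c θ φ K := hMB
  have hp0 : 0 < θ * ζ := mul_pos (by linarith) hζ1
  have hFe : ∀ r, 0 < r → FV r = Fr c θ φ r := fun r hr =>
    FV_eq hMB hK hθ1 hφ1 hφ4 FV hFV hr
  obtain ⟨C1, hC1⟩ := Fr_bound hMB hφ1 hφ4 (θ * ζ / 4) (by positivity) (by nlinarith)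
  obtain ⟨C2, hC2⟩ := Fr_bound hMB hφ1 hφ4 θ (by linarith) le_rfl
  set G : ℝ → ℝ := fun r => (Fr c θ φ r) ^ 2 with hG
  have hd : ∀ y > 0, HasDerivAt G (2 * Fr c θ φ y * Fr' c θ φ y) y := by
    intro y hy
    exact ((Fr_hasDeriv hMB hθ1 hφ1 hφ4 hy).fun_pow 2).congr_deriv (by norm_num)
  have sqb : ∀ (C a y : ℝ), 0 < y → |Fr c θ φ y| ≤ C * y ^ (-a) →
      |G y| ≤ C ^ 2 * y ^ (-(2 * a)) := by
    intro C a y hy h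
    have e : y ^ (-(2 * a)) = y ^ (-a) * y ^ (-a) := by
      rw [← Real.rpow_add hy]; congr 1; ring
    rw [hG, abs_pow, e]
    calc _ ≤ (C * y ^ (-a)) ^ 2 := by gcongr
      _ = _ := by ring
  have sqb' : ∀ (C a y : ℝ), 0 < y → |Fr c θ φ y| ≤ C * y ^ (-a) →
      |Fr' c θ φ y| ≤ C * y ^ (-a - 1) →
      |deriv G y| ≤ 2 * C ^ 2 * y ^ (-(2 * a) - 1) := by
    intro C a y hy h h'
    have e : y ^ (-(2 * a) - 1) = y ^ (-a) * y ^ (-a - 1) := by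
      rw [← Real.rpow_add hy]; congr 1; ring
    rw [(hd y hy).deriv, abs_mul, abs_mul, e, abs_of_pos (two_pos : (0:ℝ) < 2)]
    calc _ ≤ 2 * (C * y ^ (-a)) * (C * y ^ (-a - 1)) := by
          apply mul_le_mul _ h' (abs_nonneg _)
          · have := (abs_nonneg _).trans h; linarith
          · linarith
      _ = _ := by ring
  set C := max (2 * C1 ^ 2) (2 * C2 ^ 2) with hC
  have hCa : 2 * C1 ^ 2 ≤ C := le_max_left _ _
  have hCb : 2 * C2 ^ 2 ≤ C := le_max_right _ _
  have hCa' : C1 ^ 2 ≤ C := by nlinarith [sq_nonneg C1]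
  have hCb' : C2 ^ 2 ≤ C := by nlinarith [sq_nonneg C2]
  have mono : ∀ {A B y q x : ℝ}, 0 < y → x ≤ A * y ^ q → A ≤ B → x ≤ B * y ^ q :=
    fun hy h1 h2 => h1.trans (mul_le_mul_of_nonneg_right h2 (Real.rpow_pos_of_pos hy _).le)
  have main := abel θ ζ Qs (by linarith) hζ1 G (deriv G)
    (fun y hy => (hd y hy).differentiableAt.hasDerivAt) (measurable_deriv G)
    (2 * (θ * ζ / 4)) (2 * θ) C (by positivity) (by linarith) (by nlinarith)
    (fun y hy => mono hy (sqb C1 _ y hy (hC1 y hy).1) hCa')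
    (fun y hy => mono hy (sqb C2 _ y hy (hC2 y hy).1) hCb')
    (fun y hy => mono hy (sqb' C1 _ y hy (hC1 y hy).1 (hC1 y hy).2) hCa)
    (fun y hy => mono hy (sqb' C2 _ y hy (hC2 y hy).1 (hC2 y hy).2) hCb)
    lam hpos w hw hwsum hsource
  have hcongr : Set.EqOn (fun r : ℝ => r ^ (θ * ζ - 1) * (FV r) ^ 2)
      (fun r : ℝ => r ^ (θ * ζ - 1) * G r) (Set.Ioi 0) := by
    intro r hr
    simp only [hFe r hr, hG]
  refine ⟨(integrableOn_congr_fun hcongr measurableSet_Ioi).2 main.1, ?_⟩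
  rw [setIntegral_congr_fun measurableSet_Ioi hcongr]
  refine main.2.congr' ?_
  filter_upwards [eventually_gt_atTop 0] with t ht
  have ht' : (0:ℝ) < t := Nat.cast_pos.2 ht
  congr 2
  ext k
  rw [hFe _ (mul_pos ht' (Real.rpow_pos_of_pos (hpos k) _))]
end
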